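/- Let N ∈ ℕ, let λ_1, …, λ_N ∈ {0,1}, and let v_1, …, v_N ∈ ℤ[x] be ℚ-linearly independent polynomials with v_j(0) = 0 for each j ∈ {1,…,N}. Then the set of all T ∈ Aut([0,1], ℬ, μ) for which there exists a strictly increasing sequence (n_k)_{k∈ℕ} in ℕ such that for every j ∈ {1,…,N} and all measurable A, B ⊆ [0,1], lim_{k→∞} μ(A ∩ T^{−v_j(n_k)} B) = (1 − λ_j) μ(A ∩ B) + λ_j μ(A) μ(B), is a dense G_δ subset of Aut([0,1], ℬ, μ) in the weak topology. -/

import Mathlib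

open MeasureTheory Filter Topology

noncomputable section

/-- An invertible Lebesgue-measure-preserving transformation of `[0,1]`. -/
structure Aut01 : Type where
  toEquiv : unitInterval ≃ unitInterval
  measurePreserving_toFun :
    MeasurePreserving toEquiv (volume : Measure unitInterval) volume
  measurePreserving_invFun :
    MeasurePreserving toEquiv.symm (volume : Measure unitInterval) volume

namespace Aut01

/-- The correlation `μ(A ∩ T^{-m} B)` (as a real number). -/
def corr (T : Aut01) (m : ℤ) (A B : Set unitInterval) : ℝ :=
  (volume (A ∩ ⇑(T.toEquiv ^ m : Equiv.Perm unitInterval) ⁻¹' B)).toReal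

/-- The dyadic interval `[k/2^ℓ, (k+1)/2^ℓ)` of rank `ℓ`, as a subset of `[0,1]`. -/
def dyadic (ℓ k : ℕ) : Set unitInterval :=
  {x | (k : ℝ) / 2 ^ ℓ ≤ (x : ℝ) ∧ (x : ℝ) < ((k : ℝ) + 1) / 2 ^ ℓ}

/-- The metric `∂(T,S) = Σ_{ℓ≥1} 2^{-2ℓ} Σ_{E of rank ℓ} μ(TE △ SE)` inducing the weak
topology on `Aut01`. -/
def wDist (T S : Aut01) : ℝ :=
  ∑' ℓ : ℕ,
    (1 / 2 ^ (2 * (ℓ + 1)) : ℝ) *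
      ∑ k ∈ Finset.range (2 ^ (ℓ + 1)),
        (volume (symmDiff (T.toEquiv '' dyadic (ℓ + 1) k) (S.toEquiv '' dyadic (ℓ + 1) k))).toReal

/-- The weak topology on `Aut01`, generated by the balls of the metric `wDist`. -/
instance : TopologicalSpace Aut01 :=
  TopologicalSpace.generateFrom
    {U | ∃ (T : Aut01) (ε : ℝ), 0 < ε ∧ U = {S | wDist T S < ε}}

/-- `T` is aperiodic: the set of periodic points has measure zero. -/
def Aperiodic (T : Aut01) : Prop :=
  volume {x : unitInterval |
    ∃ n : ℕ, 0 < n ∧ (T.toEquiv ^ n : Equiv.Perm unitInterval) x = x} = 0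

/-- `T` is weakly mixing. -/
def WeaklyMixing (T : Aut01) : Prop :=
  ∀ A B : Set unitInterval, MeasurableSet A → MeasurableSet B →
    Tendsto
      (fun M : ℕ =>
        (1 / (M : ℝ)) *
          ∑ n ∈ Finset.Icc 1 M,
            |T.corr (n : ℤ) A B - (volume A).toReal * (volume B).toReal|)
      atTop (𝓝 0)

end Aut01

namespace Aut01

/-- The inverse transformation. -/
def inv (T : Aut01) : Aut01 where
  toEquiv := T.toEquiv⁻¹
  measurePreserving_toFun := T.measurePreserving_invFun
  measurePreserving_invFun := T.measurePreserving_toFun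

lemma measurePreserving_pow (T : Aut01) (n : ℕ) :
    MeasurePreserving ⇑(T.toEquiv ^ n : Equiv.Perm unitInterval) volume volume := by
  have h := T.measurePreserving_toFun.iterate n
  rwa [← Equiv.Perm.coe_pow] at h

lemma measurePreserving_zpow (T : Aut01) (m : ℤ) :
    MeasurePreserving ⇑(T.toEquiv ^ m : Equiv.Perm unitInterval) volume volume := by
  cases m with
  | ofNat n => simpa using T.measurePreserving_pow n
  | negSucc n =>
    have h := T.inv.measurePreserving_pow (n + 1)
    simpa [inv, zpow_negSucc, ← inv_pow] using h

/-- The measurable part of an invertible system on which a pair of almost everywhere inverse maps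
is genuinely inverse under all compositions. -/
lemma exists_invariant_conull {α : Type*} [MeasurableSpace α] {ν : Measure α} {f g : α → α}
    (hf : MeasurePreserving f ν ν) (hg : MeasurePreserving g ν ν) {s : Set α}
    (hs : MeasurableSet s) (hs' : ν sᶜ = 0) :
    ∃ t ⊆ s, MeasurableSet t ∧ ν tᶜ = 0 ∧ Set.MapsTo f t t ∧ Set.MapsTo g t t := by
  let w : List Bool → α → α := fun l => l.foldr (fun b h => h ∘ (if b then f else g)) id
  have hw : ∀ l, MeasurePreserving (w l) ν ν := by
    intro l
    induction l with
    | nil => exact MeasurePreserving.id ν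
    | cons b l ih =>
      cases b
      · exact ih.comp hg
      · exact ih.comp hf
  refine ⟨⋂ l, w l ⁻¹' s, ?_, ?_, ?_, ?_, ?_⟩
  · exact fun x hx => Set.mem_iInter.1 hx []
  · exact MeasurableSet.iInter fun l => (hw l).measurable hs
  · rw [Set.compl_iInter, measure_iUnion_null_iff]
    intro l
    rw [← Set.preimage_compl, (hw l).measure_preimage hs.compl.nullMeasurableSet, hs']
  · exact fun x hx => Set.mem_iInter.2 fun l => Set.mem_iInter.1 hx (true :: l)
  · exact fun x hx => Set.mem_iInter.2 fun l => Set.mem_iInter.1 hx (false :: l)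

/-- Measure preserving maps that are inverse to each other almost everywhere agree almost
everywhere with an invertible transformation. -/
lemma exists_of_ae_inverse {f g : unitInterval → unitInterval}
    (hf : MeasurePreserving f volume volume) (hg : MeasurePreserving g volume volume)
    (hgf : ∀ᵐ x, g (f x) = x) (hfg : ∀ᵐ x, f (g x) = x) :
    ∃ T : Aut01, T.toEquiv =ᵐ[volume] f ∧ T.toEquiv.symm =ᵐ[volume] g := by
  classical
  obtain ⟨t, hts, htm, ht0, htf, htg⟩ := exists_invariant_conull hf hg
    (s := {x | g (f x) = x} ∩ {x | f (g x) = x})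
    ((measurableSet_eq_fun (hg.measurable.comp hf.measurable) measurable_id).inter
      (measurableSet_eq_fun (hf.measurable.comp hg.measurable) measurable_id))
    (by
      have : ∀ᵐ x, x ∈ {x | g (f x) = x} ∩ {x | f (g x) = x} := by
        filter_upwards [hgf, hfg] with x h1 h2 using ⟨h1, h2⟩
      exact this)
  have hae : ∀ᵐ x, x ∈ t := ht0
  let F : unitInterval → unitInterval := t.piecewise f id
  let G : unitInterval → unitInterval := t.piecewise g id
  have hF : F =ᵐ[volume] f := by
    filter_upwards [hae] with x hx using Set.piecewise_eq_of_mem _ _ _ hx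
  have hG : G =ᵐ[volume] g := by
    filter_upwards [hae] with x hx using Set.piecewise_eq_of_mem _ _ _ hx
  have hFm : Measurable F := Measurable.piecewise htm hf.measurable measurable_id
  have hGm : Measurable G := Measurable.piecewise htm hg.measurable measurable_id
  have key : ∀ f g : unitInterval → unitInterval, Set.MapsTo f t t → (∀ x ∈ t, g (f x) = x) →
      ∀ x, t.piecewise g id (t.piecewise f id x) = x := by
    intro f g hf h x
    by_cases hx : x ∈ t
    · rw [Set.piecewise_eq_of_mem t f id hx, Set.piecewise_eq_of_mem t g id (hf hx), h x hx]
    · rw [Set.piecewise_eq_of_notMem t f id hx, id, Set.piecewise_eq_of_notMem t g id hx, id]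
  refine ⟨⟨⟨F, G, key f g htf fun x hx => (hts hx).1, key g f htg fun x hx => (hts hx).2⟩,
    ?_, ?_⟩, hF, hG⟩
  · exact ⟨hFm, (Measure.map_congr hF).trans hf.map_eq⟩
  · exact ⟨hGm, (Measure.map_congr hG).trans hg.map_eq⟩

/-- If `T` is, modulo null sets, the image of `R` under an isomorphism `θ` with inverse `ψ`, the
same holds for all powers. -/
lemma zpow_conj_ae {W : Type*} [MeasurableSpace W] {ν : Measure W} {R : W ≃ W}
    (hR : MeasurePreserving R ν ν) (hR' : MeasurePreserving R.symm ν ν)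
    {θ : W → unitInterval} {T : Aut01}
    (hT : ∀ᵐ w ∂ν, T.toEquiv (θ w) = θ (R w)) (m : ℤ) :
    ∀ᵐ w ∂ν, (T.toEquiv ^ m : Equiv.Perm unitInterval) (θ w) =
      θ ((R ^ m : Equiv.Perm W) w) := by
  have hT' : ∀ᵐ w ∂ν, T.toEquiv.symm (θ w) = θ (R.symm w) := by
    filter_upwards [hR'.quasiMeasurePreserving.ae hT] with w hw
    rw [Equiv.symm_apply_eq, hw, Equiv.apply_symm_apply]
  induction m with
  | zero => simp
  | succ n ih =>
    filter_upwards [hR.quasiMeasurePreserving.ae ih, hT] with w h1 h2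
    rw [zpow_add_one, zpow_add_one, Equiv.Perm.mul_apply, Equiv.Perm.mul_apply, h2, h1]
  | pred n ih =>
    filter_upwards [hR'.quasiMeasurePreserving.ae ih, hT'] with w h1 h2
    rw [zpow_sub_one, zpow_sub_one, Equiv.Perm.mul_apply, Equiv.Perm.mul_apply,
      Equiv.Perm.inv_def, Equiv.Perm.inv_def, h2, h1]

lemma continuous_cdf (ρ : Measure ℝ) [IsProbabilityMeasure ρ] [NullSingletonClass ρ] :
    Continuous (ProbabilityTheory.cdf ρ) := by
  rw [continuous_iff_continuousAt]
  intro x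
  have hm := (ProbabilityTheory.monotone_cdf ρ)
  rw [hm.continuousAt_iff_leftLim_eq_rightLim, StieltjesFunction.rightLim_eq]
  have h := (ProbabilityTheory.cdf ρ).measure_singleton x
  rw [ProbabilityTheory.measure_cdf, measure_singleton, eq_comm, ENNReal.ofReal_eq_zero] at h
  have := hm.leftLim_le (le_refl x)
  linarith

lemma exists_cdf_eq (ρ : Measure ℝ) [IsProbabilityMeasure ρ] [NullSingletonClass ρ] {t : ℝ}
    (h0 : 0 < t) (h1 : t < 1) : ∃ s, ProbabilityTheory.cdf ρ s = t := by
  apply mem_range_of_exists_le_of_exists_ge (continuous_cdf ρ)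
  · obtain ⟨x, hx⟩ := ((ProbabilityTheory.tendsto_cdf_atBot ρ).eventually_lt_const h0).exists
    exact ⟨x, hx.le⟩
  · obtain ⟨x, hx⟩ := ((ProbabilityTheory.tendsto_cdf_atTop ρ).eventually_const_lt h1).exists
    exact ⟨x, hx.le⟩

/-- The distribution function of an atomless law pushes it to Lebesgue measure. -/
lemma measurePreserving_cdf (ρ : Measure ℝ) [IsProbabilityMeasure ρ] [NullSingletonClass ρ] :
    MeasurePreserving (fun x => (⟨ProbabilityTheory.cdf ρ x, ProbabilityTheory.cdf_nonneg ρ x,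
      ProbabilityTheory.cdf_le_one ρ x⟩ : unitInterval)) ρ volume := by
  have hm : Measurable (fun x => (⟨ProbabilityTheory.cdf ρ x, ProbabilityTheory.cdf_nonneg ρ x,
      ProbabilityTheory.cdf_le_one ρ x⟩ : unitInterval)) :=
    (continuous_cdf ρ).measurable.subtype_mk
  refine ⟨hm, ?_⟩
  have := Measure.isProbabilityMeasure_map (μ := ρ) hm.aemeasurable
  refine Measure.ext_of_Iic _ _ fun t => ?_
  rw [Measure.map_apply hm measurableSet_Iic, unitInterval.volume_Iic]
  obtain ⟨t, ht⟩ := t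
  have ht0 := ht.1
  have ht1 := ht.2
  rcases ht1.eq_or_lt with rfl | ht1
  · convert measure_univ (μ := ρ)
    · ext x
      simpa [← Subtype.coe_le_coe] using ProbabilityTheory.cdf_le_one ρ x
    · simp
  apply le_antisymm
  · refine ENNReal.le_of_forall_pos_le_add fun ε hε _ => ?_
    obtain ⟨t', h1, h2⟩ : ∃ t', t < t' ∧ t' < min 1 (t + ε) :=
      exists_between (lt_min ht1 (by simpa using hε))
    obtain ⟨s, hs⟩ := exists_cdf_eq ρ (ht0.trans_lt h1) (h2.trans_le (min_le_left _ _))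
    calc _ ≤ ρ (Set.Iic s) := by
          refine measure_mono fun x hx => ?_
          have hx' : ProbabilityTheory.cdf ρ x ≤ t := hx
          by_contra hc
          have := ProbabilityTheory.monotone_cdf ρ (not_le.1 hc).le
          linarith
      _ = ENNReal.ofReal t' := by rw [← ProbabilityTheory.ofReal_cdf, hs]
      _ ≤ ENNReal.ofReal (t + ε) :=
          ENNReal.ofReal_le_ofReal (h2.le.trans (min_le_right _ _))
      _ = _ := (ENNReal.ofReal_add ht0 ε.2).trans (by simp)
  · rcases ht0.eq_or_lt with rfl | ht0
    · simp
    obtain ⟨s, hs⟩ := exists_cdf_eq ρ ht0 ht1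
    calc ENNReal.ofReal t = ρ (Set.Iic s) := by rw [← ProbabilityTheory.ofReal_cdf, hs]
      _ ≤ _ := measure_mono fun x hx => by
          have := ProbabilityTheory.monotone_cdf ρ hx
          rw [hs] at this
          exact this

/-- An almost everywhere injective measure preserving map between standard Borel spaces has an
almost everywhere inverse. -/
lemma exists_ae_inverse {W X : Type*} [MeasurableSpace W] [StandardBorelSpace W]
    [MeasurableSpace X] [MeasurableSpace.CountablySeparated X] {ν : Measure W} {μ : Measure X}
    [IsProbabilityMeasure ν] [IsProbabilityMeasure μ] {φ : W → X} (hφ : MeasurePreserving φ ν μ)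
    {s : Set W}
    (hs : MeasurableSet s) (hs' : ν sᶜ = 0) (hinj : Set.InjOn φ s) :
    ∃ ψ : X → W, MeasurePreserving ψ μ ν ∧ (∀ᵐ w ∂ν, ψ (φ w) = w) ∧ ∀ᵐ x ∂μ, φ (ψ x) = x := by
  have hsae : ∀ᵐ w ∂ν, w ∈ s := hs'
  have := hs.standardBorel
  have he : MeasurableEmbedding (fun w : s => φ w) :=
    (hφ.measurable.comp measurable_subtype_coe).measurableEmbedding
      (fun a b h => Subtype.ext (hinj a.2 b.2 h))
  have : Nonempty s := by
    obtain ⟨w, hw⟩ := hsae.exists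
    exact ⟨⟨w, hw⟩⟩
  let ψ : X → W := fun x => (he.invFun x : s)
  have hψm : Measurable ψ := measurable_subtype_coe.comp he.measurable_invFun
  have h1 : ∀ w ∈ s, ψ (φ w) = w := fun w hw =>
    congrArg Subtype.val (he.leftInverse_invFun ⟨w, hw⟩)
  have h1' : ∀ᵐ w ∂ν, ψ (φ w) = w := by
    filter_upwards [hsae] with w hw using h1 w hw
  refine ⟨ψ, ⟨hψm, ?_⟩, h1', ?_⟩
  · rw [← hφ.map_eq, Measure.map_map hψm hφ.measurable]
    conv_rhs => rw [← Measure.map_id (μ := ν)]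
    exact Measure.map_congr h1'
  · have hr : MeasurableSet (φ '' s) := by
      have := he.measurableSet_range
      rwa [Set.image_eq_range]
    have : ∀ᵐ x ∂μ, x ∈ φ '' s := by
      rw [← hφ.map_eq]
      refine (ae_map_iff (p := fun x => x ∈ φ '' s) hφ.measurable.aemeasurable hr).2 ?_
      filter_upwards [hsae] with w hw using ⟨w, hw, rfl⟩
    filter_upwards [this]
    rintro _ ⟨w, hw, rfl⟩
    rw [h1 w hw]

/-- An atomless standard Borel probability space is isomorphic to the unit interval in such a way
that the level sets of a given `ℕ`-valued map become consecutive intervals. -/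
lemma exists_iso_unitInterval {W : Type*} [MeasurableSpace W] [StandardBorelSpace W]
    (ν : Measure W) [IsProbabilityMeasure ν] [NullSingletonClass ν] {b : W → ℕ}
    (hb : Measurable b) :
    ∃ (φ : W → unitInterval) (ψ : unitInterval → W), MeasurePreserving φ ν volume ∧
      MeasurePreserving ψ volume ν ∧ (∀ᵐ w ∂ν, ψ (φ w) = w) ∧ (∀ᵐ t, φ (ψ t) = t) ∧
      ∀ᵐ w ∂ν, (ν.map b).real (Set.Iio (b w)) < φ w ∧ φ w < (ν.map b).real (Set.Iic (b w)) := by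
  let key : W → ℝ := fun w => b w + (unitInterval.sigmoid (embeddingReal W w) : ℝ) / 2
  have he := measurableEmbedding_sigmoid_comp_embeddingReal W
  have hkm : Measurable key := by
    refine (measurable_from_top.comp hb).add (Measurable.div_const ?_ _)
    exact measurable_subtype_coe.comp he.measurable
  have hσ : ∀ w, 0 ≤ (unitInterval.sigmoid (embeddingReal W w) : ℝ) ∧
      (unitInterval.sigmoid (embeddingReal W w) : ℝ) ≤ 1 := fun w =>
    (unitInterval.sigmoid (embeddingReal W w)).2
  have hlt : ∀ w w', b w < b w' → key w < key w' := by
    intro w w' h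
    have h' : (b w : ℝ) + 1 ≤ b w' := by exact_mod_cast h
    have := hσ w
    have := hσ w'
    simp only [key]
    linarith
  have hkinj : Function.Injective key := by
    intro w w' h
    rcases lt_trichotomy (b w) (b w') with hlt' | heq | hlt'
    · exact absurd h (hlt _ _ hlt').ne
    · apply he.injective
      apply Subtype.ext
      simp only [key, heq] at h
      simp only [Function.comp]
      linarith
    · exact absurd h (hlt _ _ hlt').ne'
  let ρ := ν.map key
  have : IsProbabilityMeasure ρ := Measure.isProbabilityMeasure_map hkm.aemeasurable
  have : NullSingletonClass ρ := by
    constructor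
    intro x
    rw [Measure.map_apply hkm (measurableSet_singleton x)]
    exact (Set.subsingleton_singleton.preimage hkinj).measure_zero ν
  have hkmp : MeasurePreserving key ν ρ := ⟨hkm, rfl⟩
  have hc := measurePreserving_cdf ρ
  set F : ℝ → unitInterval := (fun x => (⟨ProbabilityTheory.cdf ρ x,
    ProbabilityTheory.cdf_nonneg ρ x, ProbabilityTheory.cdf_le_one ρ x⟩ : unitInterval)) with hF
  have hφ : MeasurePreserving (F ∘ key) ν volume := hc.comp hkmp
  have hFmono : Monotone F := fun x y h => ProbabilityTheory.monotone_cdf ρ h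
  let s : Set W := (⋃ q : ℚ, (F ∘ key) ⁻¹' {F q})ᶜ
  have hsm : MeasurableSet s :=
    (MeasurableSet.iUnion fun q => hφ.measurable (measurableSet_singleton _)).compl
  have hs0 : ν sᶜ = 0 := by
    rw [compl_compl, measure_iUnion_null_iff]
    intro q
    rw [hφ.measure_preimage (measurableSet_singleton _).nullMeasurableSet, measure_singleton]
  have hinj : Set.InjOn (F ∘ key) s := by
    have aux : ∀ w ∈ s, ∀ w' , key w < key w' → F (key w) ≠ F (key w') := by
      intro w hw w' h heq
      obtain ⟨q, hq1, hq2⟩ := exists_rat_btwn h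
      apply hw
      refine Set.mem_iUnion.2 ⟨q, le_antisymm (hFmono hq1.le) ?_⟩
      exact (hFmono hq2.le).trans heq.ge
    intro w hw w' hw' h
    rcases lt_trichotomy (key w) (key w') with h' | h' | h'
    · exact absurd h (aux w hw w' h')
    · exact hkinj h'
    · exact absurd h.symm (aux w' hw' w h')
  obtain ⟨ψ, hψ, h1, h2⟩ := exists_ae_inverse hφ hsm hs0 hinj
  refine ⟨F ∘ key, ψ, hφ, hψ, h1, h2, ?_⟩
  have hFk : ∀ w, ((F ∘ key) w : ℝ) = ν.real (key ⁻¹' Set.Iic (key w)) := by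
    intro w
    simp only [hF, Function.comp, ProbabilityTheory.cdf_eq_real]
    rw [measureReal_def, measureReal_def, Measure.map_apply hkm measurableSet_Iic]
  have hle : ∀ w, (ν.map b).real (Set.Iio (b w)) ≤ ((F ∘ key) w : ℝ) ∧
      ((F ∘ key) w : ℝ) ≤ (ν.map b).real (Set.Iic (b w)) := by
    intro w
    rw [hFk, measureReal_def (μ := ν.map b), measureReal_def (μ := ν.map b),
      Measure.map_apply hb (measurableSet_Iio), Measure.map_apply hb (measurableSet_Iic),
      ← measureReal_def, ← measureReal_def]
    constructor
    · exact measureReal_mono fun w' hw' => (hlt _ _ hw').le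
    · refine measureReal_mono fun w' hw' => ?_
      by_contra hcon
      exact absurd (hlt _ _ (not_le.1 hcon)) (not_lt.2 hw')
  have hne : ∀ k : ℕ, ∀ᵐ w ∂ν, ((F ∘ key) w : ℝ) ≠ (ν.map b).real (Set.Iio k) ∧
      ((F ∘ key) w : ℝ) ≠ (ν.map b).real (Set.Iic k) := by
    intro k
    have aux : ∀ c : ℝ, ∀ᵐ t : unitInterval, (t : ℝ) ≠ c := by
      intro c
      have : Set.Subsingleton {t : unitInterval | ¬ ((t : ℝ) ≠ c)} := by
        intro t ht t' ht'
        simp only [ne_eq, not_not, Set.mem_ofPred_eq] at ht ht'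
        exact Subtype.ext (ht.trans ht'.symm)
      exact this.measure_zero _
    exact (hφ.quasiMeasurePreserving.ae (aux _)).and (hφ.quasiMeasurePreserving.ae (aux _))
  filter_upwards [ae_all_iff.2 hne] with w hw
  exact ⟨lt_of_le_of_ne (hle w).1 (hw _).1.symm, lt_of_le_of_ne (hle w).2 (hw _).2⟩

/-- Two atomless standard Borel probability spaces with equally distributed `ℕ`-valued maps are
isomorphic via an isomorphism respecting these maps. -/
lemma exists_iso_comp_eq {W : Type*} [MeasurableSpace W] [StandardBorelSpace W]
    (ν : Measure W) [IsProbabilityMeasure ν] [NullSingletonClass ν] {b : W → ℕ} (hb : Measurable b)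
    {a : unitInterval → ℕ} (ha : Measurable a) (hab : ν.map b = volume.map a) :
    ∃ (θ : W → unitInterval) (ψ : unitInterval → W), MeasurePreserving θ ν volume ∧
      MeasurePreserving ψ volume ν ∧ (∀ᵐ w ∂ν, ψ (θ w) = w) ∧ (∀ᵐ t, θ (ψ t) = t) ∧
      ∀ᵐ w ∂ν, a (θ w) = b w := by
  obtain ⟨φ, ψ, hφ, hψ, h1, h2, h3⟩ := exists_iso_unitInterval ν hb
  obtain ⟨φ', ψ', hφ', hψ', h1', h2', h3'⟩ := exists_iso_unitInterval volume ha
  refine ⟨ψ' ∘ φ, ψ ∘ φ', hψ'.comp hφ, hψ.comp hφ', ?_, ?_, ?_⟩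
  · filter_upwards [hφ.quasiMeasurePreserving.ae h2', h1] with w hw hw'
    simp only [Function.comp, hw, hw']
  · filter_upwards [hφ'.quasiMeasurePreserving.ae h2, h1'] with w hw hw'
    simp only [Function.comp, hw, hw']
  · filter_upwards [hφ.quasiMeasurePreserving.ae h2', h3,
      (hψ'.comp hφ).quasiMeasurePreserving.ae h3'] with w hw hw1 hw2
    simp only [Function.comp] at hw2 ⊢
    rw [hw, ← hab] at hw2
    have : IsProbabilityMeasure (ν.map b) := Measure.isProbabilityMeasure_map hb.aemeasurable
    have key : ∀ i j : ℕ, (ν.map b).real (Set.Iio i) < φ w → φ w < (ν.map b).real (Set.Iic j) →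
        i ≤ j := by
      intro i j hi hj
      by_contra hc
      have : (ν.map b).real (Set.Iic j) ≤ (ν.map b).real (Set.Iio i) :=
        measureReal_mono fun x hx => lt_of_le_of_lt hx (not_le.1 hc)
      linarith
    exact le_antisymm (key _ _ hw2.1 hw1.2) (key _ _ hw1.1 hw2.2)

/-- A factor map onto the unit interval agrees with an isomorphism as far as finitely many sets are
concerned. -/
lemma exists_iso_preimage_ae_eq {W : Type*} [MeasurableSpace W] [StandardBorelSpace W]
    {ν : Measure W} [IsProbabilityMeasure ν] [NullSingletonClass ν] {Ψ : W → unitInterval}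
    (hΨ : MeasurePreserving Ψ ν volume) {ι : Type*} [Finite ι] {A : ι → Set unitInterval}
    (hA : ∀ i, MeasurableSet (A i)) :
    ∃ (θ : W → unitInterval) (ψ : unitInterval → W), MeasurePreserving θ ν volume ∧
      MeasurePreserving ψ volume ν ∧ (∀ᵐ w ∂ν, ψ (θ w) = w) ∧ (∀ᵐ t, θ (ψ t) = t) ∧
      ∀ᵐ w ∂ν, ∀ i, θ w ∈ A i ↔ Ψ w ∈ A i := by
  classical
  obtain ⟨N, ⟨e⟩⟩ := Finite.exists_equiv_fin (ι → Prop)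
  let a : unitInterval → ℕ := fun x => (e fun i => x ∈ A i : ℕ)
  have ha : Measurable a := by
    refine (measurable_of_countable (fun p : ι → Prop => (e p : ℕ))).comp ?_
    exact measurable_pi_iff.2 fun i => measurableSet_setOfPred.1 (hA i)
  obtain ⟨θ, ψ, h1, h2, h3, h4, h5⟩ := exists_iso_comp_eq ν (ha.comp hΨ.measurable) ha
    (by rw [← hΨ.map_eq, Measure.map_map ha hΨ.measurable])
  refine ⟨θ, ψ, h1, h2, h3, h4, ?_⟩
  filter_upwards [h5] with w hw i
  have : (fun i => θ w ∈ A i) = fun i => Ψ w ∈ A i := e.injective (Fin.val_injective hw)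
  exact iff_of_eq (congrFun this i)

open scoped symmDiff

lemma measurableSet_dyadic (ℓ k : ℕ) : MeasurableSet (dyadic ℓ k) :=
  (measurableSet_le measurable_const measurable_subtype_coe).inter
    (measurableSet_lt measurable_subtype_coe measurable_const)

/-- The union of the dyadic intervals of rank `ℓ` with index in `s`. -/
def dyadicUnion (ℓ : ℕ) (s : Finset ℕ) : Set unitInterval := ⋃ k ∈ s, dyadic ℓ k

lemma measurableSet_dyadicUnion (ℓ : ℕ) (s : Finset ℕ) : MeasurableSet (dyadicUnion ℓ s) :=
  Finset.measurableSet_biUnion s fun k _ => measurableSet_dyadic ℓ k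

lemma exists_mem_dyadic (ℓ : ℕ) {x : unitInterval} (hx : x ≠ 1) :
    ∃ k < 2 ^ ℓ, x ∈ dyadic ℓ k := by
  have hx1 : (x : ℝ) < 1 := lt_of_le_of_ne x.2.2 fun h => hx (Subtype.ext h)
  have h2 : (0 : ℝ) < 2 ^ ℓ := by positivity
  have hnn : 0 ≤ (x : ℝ) * 2 ^ ℓ := mul_nonneg x.2.1 h2.le
  refine ⟨⌊(x : ℝ) * 2 ^ ℓ⌋₊, ?_, ?_, ?_⟩
  · rw [Nat.floor_lt hnn]
    push_cast
    nlinarith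
  · rw [div_le_iff₀ h2]
    exact Nat.floor_le hnn
  · rw [lt_div_iff₀ h2]
    exact Nat.lt_floor_add_one _

lemma dist_lt_of_mem_dyadic {ℓ k : ℕ} {x y : unitInterval} (hx : x ∈ dyadic ℓ k)
    (hy : y ∈ dyadic ℓ k) : dist x y < 1 / 2 ^ ℓ := by
  obtain ⟨h1, h2⟩ := hx
  obtain ⟨h3, h4⟩ := hy
  rw [add_div] at h2 h4
  rw [Subtype.dist_eq, Real.dist_eq, abs_lt]
  constructor <;> linarith

/-- A measurable set contains a compact set and is contained in an open one, separated by a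
positive distance, that are close to it in measure. -/
lemma exists_compact_open_approx {A : Set unitInterval} (hA : MeasurableSet A) {ε : ENNReal}
    (hε : ε ≠ 0) : ∃ K O : Set unitInterval, MeasurableSet K ∧ MeasurableSet O ∧ K ⊆ A ∧ A ⊆ O ∧
      volume (A \ K) < ε ∧ volume (O \ A) < ε ∧
      ∃ δ > 0, ∀ x ∈ K, ∀ y, dist x y < δ → y ∈ O := by
  obtain ⟨K, hKA, hK, hKε⟩ := hA.exists_isCompact_sdiff_lt (measure_ne_top volume A) hε
  obtain ⟨O, hAO, hO, -, hOε⟩ := hA.exists_isOpen_sdiff_lt (measure_ne_top volume A) hε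
  obtain ⟨δ, hδ, hsub⟩ := hK.exists_thickening_subset_open hO (hKA.trans hAO)
  refine ⟨K, O, hK.measurableSet, hO.measurableSet, hKA, hAO, hKε, hOε, δ, hδ, ?_⟩
  intro x hx y hxy
  exact hsub (Metric.mem_thickening_iff.2 ⟨x, hx, by rwa [dist_comm]⟩)

lemma exists_dyadicUnion_approx {A : Set unitInterval} (hA : MeasurableSet A) {ε : ENNReal}
    (hε : ε ≠ 0) :
    ∃ ℓ₀, ∀ ℓ ≥ ℓ₀, ∃ s ⊆ Finset.range (2 ^ ℓ), volume (A ∆ dyadicUnion ℓ s) < ε := by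
  classical
  obtain ⟨K, O, -, -, hKA, hAO, hK, hO, δ, hδ, h⟩ := exists_compact_open_approx hA
    (ENNReal.half_pos hε).ne'
  obtain ⟨ℓ₀, hℓ₀⟩ := exists_pow_lt_of_lt_one hδ (by norm_num : (1 / 2 : ℝ) < 1)
  refine ⟨ℓ₀, fun ℓ hℓ => ⟨(Finset.range (2 ^ ℓ)).filter fun k => (dyadic ℓ k ∩ K).Nonempty,
    Finset.filter_subset _ _, ?_⟩⟩
  have hsub : A ∆ dyadicUnion ℓ ((Finset.range (2 ^ ℓ)).filter
      fun k => (dyadic ℓ k ∩ K).Nonempty) ⊆ ((A \ K) ∪ {1}) ∪ (O \ A) := by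
    rintro x (⟨hx, hxU⟩ | ⟨hxU, hx⟩)
    · left
      by_contra hcon
      simp only [Set.mem_union, Set.mem_sdiff, Set.mem_singleton_iff, not_or, not_and,
        not_not] at hcon
      obtain ⟨k, hk, hxk⟩ := exists_mem_dyadic ℓ hcon.2
      refine hxU (Set.mem_biUnion (x := k) ?_ hxk)
      simp only [Finset.coe_filter, Finset.mem_range]
      exact ⟨hk, x, hxk, hcon.1 hx⟩
    · right
      refine ⟨?_, hx⟩
      obtain ⟨k, hk, hxk⟩ := Set.mem_iUnion₂.1 hxU
      obtain ⟨y, hyk, hyK⟩ := (Finset.mem_filter.1 hk).2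
      refine h y hyK x ((dist_lt_of_mem_dyadic hyk hxk).trans_le ?_)
      refine le_trans ?_ hℓ₀.le
      rw [one_div_pow]
      exact one_div_le_one_div_of_le (by positivity) (pow_le_pow_right₀ (by norm_num) hℓ)
  calc _ ≤ volume (((A \ K) ∪ {1}) ∪ (O \ A)) := measure_mono hsub
    _ ≤ volume (A \ K) + volume {(1 : unitInterval)} + volume (O \ A) :=
      (measure_union_le _ _).trans (add_le_add_left (measure_union_le _ _) _)
    _ < ε / 2 + ε / 2 := by
      rw [measure_singleton, add_zero]
      exact ENNReal.add_lt_add hK hO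
    _ = ε := ENNReal.add_halves ε

lemma measurableSet_image (T : Aut01) {A : Set unitInterval} (hA : MeasurableSet A) :
    MeasurableSet (T.toEquiv '' A) := by
  rw [Equiv.image_eq_preimage_symm]
  exact T.measurePreserving_invFun.measurable hA

lemma measure_image (T : Aut01) {A : Set unitInterval} (hA : MeasurableSet A) :
    volume (T.toEquiv '' A) = volume A := by
  rw [Equiv.image_eq_preimage_symm]
  exact T.measurePreserving_invFun.measure_preimage hA.nullMeasurableSet

lemma measure_image_symmDiff (T : Aut01) {A B : Set unitInterval} (hA : MeasurableSet A)
    (hB : MeasurableSet B) : volume ((T.toEquiv '' A) ∆ (T.toEquiv '' B)) = volume (A ∆ B) := by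
  rw [← Set.image_symmDiff T.toEquiv.injective, T.measure_image (hA.symmDiff hB)]

/-- Setwise convergence along a filter. -/
def SetTendsto (l : Filter Aut01) (T : Aut01) : Prop :=
  ∀ A, MeasurableSet A → Tendsto (fun S : Aut01 => volume ((S.toEquiv '' A) ∆ (T.toEquiv '' A)))
    l (𝓝 0)

lemma abs_toReal_sub_le {X : Type*} [MeasurableSpace X] {μ : Measure X}
    [IsFiniteMeasure μ] (A B : Set X) :
    |(μ A).toReal - (μ B).toReal| ≤ (μ (A ∆ B)).toReal := by
  have h : ∀ A B : Set X,
      (μ A).toReal ≤ (μ B).toReal + (μ (A ∆ B)).toReal := by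
    intro A B
    rw [← ENNReal.toReal_add (measure_ne_top _ _) (measure_ne_top _ _)]
    refine ENNReal.toReal_mono (by simp) (le_trans (measure_mono ?_) (measure_union_le _ _))
    intro x hx
    by_cases hB : x ∈ B
    · exact Or.inl hB
    · exact Or.inr (Or.inl ⟨hx, hB⟩)
  rw [abs_le]
  have h1 := h A B
  have h2 := h B A
  rw [symmDiff_comm] at h2
  constructor <;> linarith

lemma toReal_symmDiff_le_one (A : Set unitInterval) : (volume A).toReal ≤ 1 := by
  rw [← ENNReal.toReal_one]
  exact ENNReal.toReal_mono (by simp) prob_le_one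

lemma wDist_term_le (T S : Aut01) (ℓ : ℕ) :
    (1 / 2 ^ (2 * (ℓ + 1)) : ℝ) * ∑ k ∈ Finset.range (2 ^ (ℓ + 1)),
      (volume (symmDiff (T.toEquiv '' dyadic (ℓ + 1) k)
        (S.toEquiv '' dyadic (ℓ + 1) k))).toReal ≤ (1 / 2) ^ ℓ := by
  have h : ∑ k ∈ Finset.range (2 ^ (ℓ + 1)), (volume (symmDiff (T.toEquiv '' dyadic (ℓ + 1) k)
        (S.toEquiv '' dyadic (ℓ + 1) k))).toReal ≤ 2 ^ (ℓ + 1) := by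
    refine (Finset.sum_le_card_nsmul _ _ 1 fun k _ => toReal_symmDiff_le_one _).trans ?_
    simp
  have h2 : (0 : ℝ) < 2 ^ (ℓ + 1) := by positivity
  calc _ ≤ (1 / 2 ^ (2 * (ℓ + 1)) : ℝ) * 2 ^ (ℓ + 1) := by gcongr
    _ = 1 / 2 ^ (ℓ + 1) := by rw [two_mul, pow_add]; field_simp
    _ ≤ 1 / 2 ^ ℓ := one_div_le_one_div_of_le (by positivity)
        (pow_le_pow_right₀ (by norm_num) (Nat.le_succ ℓ))
    _ = (1 / 2) ^ ℓ := by rw [one_div_pow]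

lemma wDist_term_nonneg (T S : Aut01) (ℓ : ℕ) :
    0 ≤ (1 / 2 ^ (2 * (ℓ + 1)) : ℝ) * ∑ k ∈ Finset.range (2 ^ (ℓ + 1)),
      (volume (symmDiff (T.toEquiv '' dyadic (ℓ + 1) k)
        (S.toEquiv '' dyadic (ℓ + 1) k))).toReal := by
  positivity

lemma summable_wDist (T S : Aut01) : Summable fun ℓ : ℕ =>
    (1 / 2 ^ (2 * (ℓ + 1)) : ℝ) * ∑ k ∈ Finset.range (2 ^ (ℓ + 1)),
      (volume (symmDiff (T.toEquiv '' dyadic (ℓ + 1) k)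
        (S.toEquiv '' dyadic (ℓ + 1) k))).toReal :=
  Summable.of_nonneg_of_le (wDist_term_nonneg T S) (wDist_term_le T S)
    (summable_geometric_of_lt_one (by norm_num) (by norm_num))

/-- Convergence on the dyadic intervals implies convergence in the weak topology. -/
lemma le_nhds_of_tendsto_dyadic {l : Filter Aut01} {T : Aut01}
    (h : ∀ ℓ k, k < 2 ^ (ℓ + 1) → Tendsto (fun S : Aut01 =>
      volume ((S.toEquiv '' dyadic (ℓ + 1) k) ∆ (T.toEquiv '' dyadic (ℓ + 1) k))) l (𝓝 0)) :
    l ≤ 𝓝 T := by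
  refine tendsto_id'.1 (TopologicalSpace.tendsto_nhds_generateFrom_iff.2 ?_)
  rintro _ ⟨T₀, ε, hε, rfl⟩ hT
  have hlim : Tendsto (fun S => wDist T₀ S) l (𝓝 (wDist T₀ T)) := by
    refine tendsto_tsum_of_dominated_convergence (bound := fun ℓ : ℕ => (1 / 2 : ℝ) ^ ℓ)
      (summable_geometric_of_lt_one (by norm_num) (by norm_num)) ?_ ?_
    · intro ℓ
      refine Tendsto.const_mul _ (tendsto_finsetSum _ fun k hk => ?_)
      have h0 := (ENNReal.tendsto_toReal ENNReal.zero_ne_top).comp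
        (h ℓ k (Finset.mem_range.1 hk))
      rw [ENNReal.toReal_zero] at h0
      rw [tendsto_iff_dist_tendsto_zero]
      refine squeeze_zero (fun _ => dist_nonneg) (fun S => ?_) h0
      rw [Real.dist_eq]
      refine (abs_toReal_sub_le _ _).trans (le_of_eq ?_)
      rw [symmDiff_symmDiff_symmDiff_comm, symmDiff_self, bot_symmDiff, Function.comp_apply]
    · refine Eventually.of_forall fun S ℓ => ?_
      rw [Real.norm_of_nonneg (wDist_term_nonneg T₀ S ℓ)]
      exact wDist_term_le T₀ S ℓ
  exact hlim.eventually_lt_const hT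

lemma tendsto_dyadic_nhds (T : Aut01) (ℓ k : ℕ) (hk : k < 2 ^ (ℓ + 1)) :
    Tendsto (fun S : Aut01 =>
      volume ((S.toEquiv '' dyadic (ℓ + 1) k) ∆ (T.toEquiv '' dyadic (ℓ + 1) k)))
      (𝓝 T) (𝓝 0) := by
  have h0 : Tendsto (fun S => wDist T S) (𝓝 T) (𝓝 0) := by
    rw [Metric.tendsto_nhds]
    intro ε hε
    have hmem : {S | wDist T S < ε} ∈ 𝓝 T := by
      refine IsOpen.mem_nhds (TopologicalSpace.isOpen_generateFrom_of_mem ⟨T, ε, hε, rfl⟩) ?_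
      simpa [wDist] using hε
    filter_upwards [hmem] with S hS
    rw [Real.dist_eq, sub_zero, abs_of_nonneg]
    · exact hS
    · exact tsum_nonneg (wDist_term_nonneg T S)
  have h1 : Tendsto (fun S : Aut01 => (volume ((S.toEquiv '' dyadic (ℓ + 1) k) ∆
      (T.toEquiv '' dyadic (ℓ + 1) k))).toReal) (𝓝 T) (𝓝 0) := by
    have h2 := h0.const_mul ((2 : ℝ) ^ (2 * (ℓ + 1)))
    rw [mul_zero] at h2
    refine squeeze_zero (fun _ => ENNReal.toReal_nonneg) (fun S => ?_) h2
    have h3 := (summable_wDist T S).le_tsum ℓ fun i _ => wDist_term_nonneg T S i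
    have h4 : (volume ((S.toEquiv '' dyadic (ℓ + 1) k) ∆
      (T.toEquiv '' dyadic (ℓ + 1) k))).toReal ≤ ∑ k ∈ Finset.range (2 ^ (ℓ + 1)),
        (volume (symmDiff (T.toEquiv '' dyadic (ℓ + 1) k)
        (S.toEquiv '' dyadic (ℓ + 1) k))).toReal := by
      rw [symmDiff_comm]
      exact Finset.single_le_sum (f := fun k => (volume (symmDiff
        (T.toEquiv '' dyadic (ℓ + 1) k) (S.toEquiv '' dyadic (ℓ + 1) k))).toReal)
        (fun _ _ => ENNReal.toReal_nonneg) (Finset.mem_range.2 hk)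
    calc _ ≤ _ := h4
      _ = 2 ^ (2 * (ℓ + 1)) * ((1 / 2 ^ (2 * (ℓ + 1)) : ℝ) * _) := by field_simp
      _ ≤ _ := by
        gcongr
        exact h3
  rw [← ENNReal.tendsto_toReal_iff (fun _ => measure_ne_top _ _) ENNReal.zero_ne_top]
  simpa using h1

lemma setTendsto_nhds (T : Aut01) : SetTendsto (𝓝 T) T := by
  intro A hA
  rw [ENNReal.tendsto_nhds_zero]
  intro ε hε
  have hε3 : ε / 3 ≠ 0 := (ENNReal.div_pos hε.ne' (by norm_num)).ne'
  obtain ⟨ℓ₀, h⟩ := exists_dyadicUnion_approx hA hε3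
  obtain ⟨s, hs, hsε⟩ := h (ℓ₀ + 1) (Nat.le_succ _)
  set U := dyadicUnion (ℓ₀ + 1) s with hU
  have hUm : MeasurableSet U := measurableSet_dyadicUnion _ _
  have hlim : Tendsto (fun S : Aut01 => ∑ k ∈ s, volume ((S.toEquiv '' dyadic (ℓ₀ + 1) k) ∆
      (T.toEquiv '' dyadic (ℓ₀ + 1) k))) (𝓝 T) (𝓝 0) := by
    have := tendsto_finsetSum s fun k hk =>
      tendsto_dyadic_nhds T ℓ₀ k (Finset.mem_range.1 (hs hk))
    simpa using this
  filter_upwards [hlim.eventually_lt_const (pos_iff_ne_zero.2 hε3)] with S hS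
  have hSU : volume ((S.toEquiv '' U) ∆ (T.toEquiv '' U)) ≤ ε / 3 := by
    refine le_trans ?_ hS.le
    refine le_trans (measure_mono ?_) (measure_biUnion_finset_le s _)
    rw [hU, dyadicUnion, Set.image_iUnion₂, Set.image_iUnion₂]
    rintro x (⟨h1, h2⟩ | ⟨h1, h2⟩)
    · obtain ⟨k, hk, hx⟩ := Set.mem_iUnion₂.1 h1
      exact Set.mem_iUnion₂.2 ⟨k, hk, Or.inl ⟨hx, fun h => h2 (Set.mem_iUnion₂.2 ⟨k, hk, h⟩)⟩⟩
    · obtain ⟨k, hk, hx⟩ := Set.mem_iUnion₂.1 h1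
      exact Set.mem_iUnion₂.2 ⟨k, hk, Or.inr ⟨hx, fun h => h2 (Set.mem_iUnion₂.2 ⟨k, hk, h⟩)⟩⟩
  calc _ ≤ volume ((S.toEquiv '' A) ∆ (S.toEquiv '' U)) +
        (volume ((S.toEquiv '' U) ∆ (T.toEquiv '' U)) +
          volume ((T.toEquiv '' U) ∆ (T.toEquiv '' A))) :=
        (measure_symmDiff_le _ _ _).trans (add_le_add_right (measure_symmDiff_le _ _ _) _)
    _ ≤ ε / 3 + (ε / 3 + ε / 3) := by
        rw [measure_image_symmDiff _ hA hUm, measure_image_symmDiff _ hUm hA, symmDiff_comm U]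
        gcongr
    _ = ε := by rw [← add_assoc, ENNReal.add_thirds]

lemma SetTendsto.le_nhds {l : Filter Aut01} {T : Aut01} (h : SetTendsto l T) : l ≤ 𝓝 T :=
  le_nhds_of_tendsto_dyadic fun _ _ _ => h _ (measurableSet_dyadic _ _)

/-- Setwise convergence of preimages under all powers. -/
lemma SetTendsto.zpow {l : Filter Aut01} {T : Aut01} (h : SetTendsto l T) (m : ℤ)
    {A : Set unitInterval} (hA : MeasurableSet A) :
    Tendsto (fun S : Aut01 => volume (((S.toEquiv ^ m : Equiv.Perm unitInterval) '' A) ∆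
      ((T.toEquiv ^ m : Equiv.Perm unitInterval) '' A))) l (𝓝 0) := by
  have hinv : ∀ A, MeasurableSet A → Tendsto (fun S : Aut01 => volume ((S.inv.toEquiv '' A) ∆
      (T.inv.toEquiv '' A))) l (𝓝 0) := by
    intro A hA
    refine (h _ (T.inv.measurableSet_image hA)).congr fun S => ?_
    have hTA : T.toEquiv '' (T.inv.toEquiv '' A) = A := T.toEquiv.image_symm_image A
    have hSA : S.toEquiv '' (S.inv.toEquiv '' A) = A := S.toEquiv.image_symm_image A
    have := S.measure_image_symmDiff (T.inv.measurableSet_image hA) (S.inv.measurableSet_image hA)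
    rw [hSA] at this
    rw [hTA, this, symmDiff_comm]
  have step : ∀ (f : Aut01 → Aut01), (∀ A, MeasurableSet A → Tendsto (fun S : Aut01 =>
      volume (((f S).toEquiv '' A) ∆ ((f T).toEquiv '' A))) l (𝓝 0)) → ∀ (p : ℤ),
      (∀ A, MeasurableSet A → Tendsto (fun S : Aut01 =>
      volume (((S.toEquiv ^ p : Equiv.Perm unitInterval) '' A) ∆
        ((T.toEquiv ^ p : Equiv.Perm unitInterval) '' A))) l (𝓝 0)) →
      ∀ A, MeasurableSet A → Tendsto (fun S : Aut01 =>
      volume ((((f S).toEquiv * S.toEquiv ^ p : Equiv.Perm unitInterval) '' A) ∆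
        (((f T).toEquiv * T.toEquiv ^ p : Equiv.Perm unitInterval) '' A))) l (𝓝 0) := by
    intro f hf p hp A hA
    have him : ∀ S : Aut01, MeasurableSet ((S.toEquiv ^ p : Equiv.Perm unitInterval) '' A) := by
      intro S
      rw [Equiv.image_eq_preimage_symm, ← Equiv.Perm.inv_def, ← zpow_neg]
      exact (S.measurePreserving_zpow _).measurable hA
    have hsum := (hp A hA).add (hf _ (him T))
    rw [add_zero] at hsum
    refine tendsto_of_tendsto_of_tendsto_of_le_of_le tendsto_const_nhds hsum
      (fun _ => zero_le) fun S => ?_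
    simp only [Equiv.Perm.coe_mul, Set.image_comp]
    refine (measure_symmDiff_le _ ((f S).toEquiv ''
      ((T.toEquiv ^ p : Equiv.Perm unitInterval) '' A))
      _).trans ?_
    rw [(f S).measure_image_symmDiff (him S) (him T)]
  have main : ∀ A, MeasurableSet A → Tendsto (fun S : Aut01 =>
      volume (((S.toEquiv ^ m : Equiv.Perm unitInterval) '' A) ∆
      ((T.toEquiv ^ m : Equiv.Perm unitInterval) '' A))) l (𝓝 0) := by
    induction m with
    | zero => intro A hA; simpa using tendsto_const_nhds
    | succ n ih =>
      have := step id h _ ih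
      simpa only [id, mul_self_zpow, ← zpow_one_add, add_comm (1 : ℤ)] using this
    | pred n ih =>
      have := step inv hinv _ ih
      intro A hA
      have := this A hA
      simp only [inv, ← zpow_neg_one, ← zpow_add] at this
      rwa [sub_eq_neg_add]
  exact main A hA

lemma corr_eq_image (T : Aut01) (m : ℤ) (A B : Set unitInterval) :
    T.corr m A B =
      (volume (A ∩ (T.toEquiv ^ (-m) : Equiv.Perm unitInterval) '' B)).toReal := by
  rw [corr, Equiv.image_eq_preimage_symm, ← Equiv.Perm.inv_def, zpow_neg, inv_inv]

lemma continuous_corr (m : ℤ) (A : Set unitInterval) {B : Set unitInterval}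
    (hB : MeasurableSet B) : Continuous fun T : Aut01 => T.corr m A B := by
  rw [continuous_iff_continuousAt]
  intro T
  have h := (ENNReal.tendsto_toReal ENNReal.zero_ne_top).comp
    ((setTendsto_nhds T).zpow (-m) hB)
  rw [ENNReal.toReal_zero] at h
  rw [ContinuousAt, tendsto_iff_dist_tendsto_zero]
  refine squeeze_zero (fun _ => dist_nonneg) (fun S => ?_) h
  rw [Real.dist_eq, corr_eq_image, corr_eq_image]
  refine (abs_toReal_sub_le _ _).trans (ENNReal.toReal_mono (measure_ne_top _ _)
    (measure_mono ?_))
  rw [← Set.inter_symmDiff_distrib_left]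
  exact Set.inter_subset_right

lemma abs_corr_sub_corr_le (T : Aut01) (m : ℤ) {A A' B B' : Set unitInterval}
    (hB : MeasurableSet B) (hB' : MeasurableSet B') :
    |T.corr m A B - T.corr m A' B'| ≤ (volume (A ∆ A')).toReal + (volume (B ∆ B')).toReal := by
  refine (abs_toReal_sub_le _ _).trans ?_
  rw [← ENNReal.toReal_add (measure_ne_top _ _) (measure_ne_top _ _),
    ← (T.measurePreserving_zpow m).measure_preimage (hB.symmDiff hB').nullMeasurableSet]
  refine ENNReal.toReal_mono (by simp) (le_trans (measure_mono ?_) (measure_union_le _ _))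
  rintro x (⟨⟨h1, h2⟩, h3⟩ | ⟨⟨h1, h2⟩, h3⟩)
  · by_cases hx : x ∈ A'
    · exact Or.inr (Or.inl ⟨h2, fun h => h3 ⟨hx, h⟩⟩)
    · exact Or.inl (Or.inl ⟨h1, hx⟩)
  · by_cases hx : x ∈ A
    · exact Or.inr (Or.inr ⟨h2, fun h => h3 ⟨hx, h⟩⟩)
    · exact Or.inl (Or.inr ⟨h1, hx⟩)

lemma memLp_coord (T : Aut01) : MemLp (fun x => (T.toEquiv x : ℝ)) 1 volume := by
  refine MemLp.of_bound (C := 1) ?_ ?_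
  · exact (measurable_subtype_coe.comp T.measurePreserving_toFun.measurable).aestronglyMeasurable
  · refine Eventually.of_forall fun x => ?_
    rw [Real.norm_of_nonneg (T.toEquiv x).2.1]
    exact (T.toEquiv x).2.2

/-- The transformation, viewed as a real valued integrable function. -/
def toL1 (T : Aut01) : Lp ℝ 1 (volume : Measure unitInterval) := T.memLp_coord.toLp _

/-- The transformation and its inverse, viewed as real valued integrable functions. -/
def toL1Prod (T : Aut01) :
    Lp ℝ 1 (volume : Measure unitInterval) × Lp ℝ 1 (volume : Measure unitInterval) :=
  (T.toL1, T.inv.toL1)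

lemma coeFn_toL1 (T : Aut01) : T.toL1 =ᵐ[volume] fun x => (T.toEquiv x : ℝ) :=
  T.memLp_coord.coeFn_toLp

lemma tendsto_inv_nhds (T : Aut01) : Tendsto inv (𝓝 T) (𝓝 T.inv) := by
  refine SetTendsto.le_nhds fun A hA => ?_
  rw [tendsto_map'_iff]
  simpa [inv, Function.comp_def] using (setTendsto_nhds T).zpow (-1) hA

lemma continuous_toL1 : Continuous toL1 := by
  rw [continuous_iff_continuousAt]
  intro T
  refine (Lp.tendsto_Lp_iff_tendsto_eLpNorm'' (fun S : Aut01 => fun x => (S.toEquiv x : ℝ))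
    memLp_coord _ T.memLp_coord).2 ?_
  rw [ENNReal.tendsto_nhds_zero]
  intro ε hε
  obtain ⟨ℓ, hℓ⟩ : ∃ ℓ : ℕ, ENNReal.ofReal ((1 / 2) ^ ℓ) < ε / 2 := by
    have h1 : Tendsto (fun ℓ : ℕ => ENNReal.ofReal ((1 / 2) ^ ℓ)) atTop (𝓝 0) := by
      rw [← ENNReal.ofReal_zero]
      exact ENNReal.tendsto_ofReal
        (tendsto_pow_atTop_nhds_zero_of_lt_one (by norm_num) (by norm_num))
    exact (h1.eventually_lt_const (ENNReal.half_pos hε.ne')).exists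
  have hlim : Tendsto (fun S : Aut01 => ∑ k ∈ Finset.range (2 ^ ℓ),
      volume ((S.toEquiv ⁻¹' dyadic ℓ k) ∆ (T.toEquiv ⁻¹' dyadic ℓ k))) (𝓝 T) (𝓝 0) := by
    have := tendsto_finsetSum (Finset.range (2 ^ ℓ)) fun k _ =>
      (setTendsto_nhds T).zpow (-1) (measurableSet_dyadic ℓ k)
    simpa [Equiv.Perm.inv_def, Equiv.image_symm_eq_preimage] using this
  filter_upwards [hlim.eventually_lt_const (ENNReal.half_pos hε.ne')] with S hS
  have hne : ∀ᵐ x, S.toEquiv x ≠ 1 := S.measurePreserving_toFun.quasiMeasurePreserving.ae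
    (by simp [ae_iff] : ∀ᵐ x : unitInterval, x ≠ 1)
  have hm : ∀ k, MeasurableSet ((S.toEquiv ⁻¹' dyadic ℓ k) ∆ (T.toEquiv ⁻¹' dyadic ℓ k)) :=
    fun k => (S.measurePreserving_toFun.measurable (measurableSet_dyadic ℓ k)).symmDiff
      (T.measurePreserving_toFun.measurable (measurableSet_dyadic ℓ k))
  rw [eLpNorm_one_eq_lintegral_enorm]
  calc _ ≤ ∫⁻ x, (ENNReal.ofReal ((1 / 2) ^ ℓ) + ∑ k ∈ Finset.range (2 ^ ℓ),
        ((S.toEquiv ⁻¹' dyadic ℓ k) ∆ (T.toEquiv ⁻¹' dyadic ℓ k)).indicator 1 x) := by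
        refine lintegral_mono_ae ?_
        filter_upwards [hne] with x hx
        obtain ⟨k, hk, hxk⟩ := exists_mem_dyadic ℓ hx
        by_cases hxT : T.toEquiv x ∈ dyadic ℓ k
        · refine le_trans ?_ le_self_add
          rw [Pi.sub_apply, ← ofReal_norm]
          refine ENNReal.ofReal_le_ofReal ?_
          rw [one_div_pow]
          exact (dist_lt_of_mem_dyadic hxk hxT).le
        · refine le_trans ?_ le_add_self
          refine le_trans ?_ (Finset.single_le_sum (fun _ _ => zero_le)
            (Finset.mem_range.2 hk))
          have hmem : x ∈ (S.toEquiv ⁻¹' dyadic ℓ k) ∆ (T.toEquiv ⁻¹' dyadic ℓ k) :=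
            Or.inl ⟨hxk, hxT⟩
          rw [Set.indicator_of_mem hmem, Pi.sub_apply, ← ofReal_norm,
            Pi.one_apply, ENNReal.ofReal_le_one, Real.norm_eq_abs, abs_le]
          have h1 := (S.toEquiv x).2
          have h2 := (T.toEquiv x).2
          constructor <;> linarith [h1.1, h1.2, h2.1, h2.2]
    _ = ENNReal.ofReal ((1 / 2) ^ ℓ) + ∑ k ∈ Finset.range (2 ^ ℓ),
        volume ((S.toEquiv ⁻¹' dyadic ℓ k) ∆ (T.toEquiv ⁻¹' dyadic ℓ k)) := by
        rw [lintegral_add_left measurable_const, lintegral_const, measure_univ, mul_one,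
          lintegral_finsetSum _ fun k _ => measurable_one.indicator (hm k)]
        congr 1
        exact Finset.sum_congr rfl fun k _ => lintegral_indicator_one (hm k)
    _ ≤ ε / 2 + ε / 2 := add_le_add hℓ.le hS.le
    _ = ε := ENNReal.add_halves ε

lemma continuous_toL1Prod : Continuous toL1Prod := by
  refine continuous_toL1.prodMk ?_
  rw [continuous_iff_continuousAt]
  exact fun T => continuous_toL1.continuousAt.tendsto.comp (tendsto_inv_nhds T)

lemma tendstoInMeasure_of_tendsto_toL1 {ι : Type*} {l : Filter ι} {S : ι → Aut01}
    {F : Lp ℝ 1 (volume : Measure unitInterval)} (h : Tendsto (fun i => (S i).toL1) l (𝓝 F)) :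
    TendstoInMeasure volume (fun i x => ((S i).toEquiv x : ℝ)) l F :=
  (tendstoInMeasure_of_tendsto_Lp h).congr_left fun i => (S i).coeFn_toL1

lemma setTendsto_of_tendsto_toL1 {l : Filter Aut01} {T : Aut01}
    (h : Tendsto (fun S => S.inv.toL1) l (𝓝 T.inv.toL1)) : SetTendsto l T := by
  have hmeas := (tendstoInMeasure_of_tendsto_toL1 h).congr_right T.inv.coeFn_toL1
  rw [tendstoInMeasure_iff_dist] at hmeas
  intro A hA
  rw [ENNReal.tendsto_nhds_zero]
  intro ε hε
  have hε5 : ε / 5 ≠ 0 := (ENNReal.div_pos hε.ne' (by norm_num)).ne'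
  obtain ⟨K, O, hK, hO, hKA, hAO, hKε, hOε, δ, hδ, hsep⟩ := exists_compact_open_approx hA hε5
  have hev := (hmeas δ hδ).eventually_lt_const (pos_iff_ne_zero.2 hε5)
  filter_upwards [hev] with S hS
  have hsub : (S.toEquiv '' A) ∆ (T.toEquiv '' A) ⊆
      (S.toEquiv '' (A \ K)) ∪ ((T.toEquiv '' (A \ K)) ∪ ((S.toEquiv '' (O \ A)) ∪
      ((T.toEquiv '' (O \ A)) ∪
      {x | δ ≤ dist (S.inv.toEquiv x : ℝ) (T.inv.toEquiv x : ℝ)}))) := by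
    have key : ∀ S T : Aut01, ∀ x, x ∈ S.toEquiv '' A → x ∉ T.toEquiv '' A →
        dist (S.inv.toEquiv x : ℝ) (T.inv.toEquiv x : ℝ) < δ →
        x ∈ S.toEquiv '' (A \ K) ∨ x ∈ T.toEquiv '' (O \ A) := by
      intro S T x hxS hxT hd
      simp only [Equiv.image_eq_preimage_symm, Set.mem_preimage] at hxS hxT ⊢
      by_cases hxK : S.toEquiv.symm x ∈ K
      · exact Or.inr ⟨hsep _ hxK _ hd, hxT⟩
      · exact Or.inl ⟨hxS, hxK⟩
    intro x hx
    by_cases hd : δ ≤ dist (S.inv.toEquiv x : ℝ) (T.inv.toEquiv x : ℝ)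
    · exact Or.inr (Or.inr (Or.inr (Or.inr hd)))
    rw [not_le] at hd
    rcases hx with ⟨h1, h2⟩ | ⟨h1, h2⟩
    · rcases key S T x h1 h2 hd with h | h
      · exact Or.inl h
      · exact Or.inr (Or.inr (Or.inr (Or.inl h)))
    · rcases key T S x h1 h2 (by rwa [dist_comm]) with h | h
      · exact Or.inr (Or.inl h)
      · exact Or.inr (Or.inr (Or.inl h))
  have h1 : ∀ S : Aut01, volume (S.toEquiv '' (A \ K)) ≤ ε / 5 := fun S =>
    (S.measure_image (hA.diff hK)).trans_le hKε.le
  have h2 : ∀ S : Aut01, volume (S.toEquiv '' (O \ A)) ≤ ε / 5 := fun S =>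
    (S.measure_image (hO.diff hA)).trans_le hOε.le
  calc _ ≤ _ := measure_mono hsub
    _ ≤ ε / 5 + (ε / 5 + (ε / 5 + (ε / 5 + ε / 5))) := by
      refine (measure_union_le _ _).trans (add_le_add (h1 S) ?_)
      refine (measure_union_le _ _).trans (add_le_add (h1 T) ?_)
      refine (measure_union_le _ _).trans (add_le_add (h2 S) ?_)
      exact (measure_union_le _ _).trans (add_le_add (h2 T) hS.le)
    _ = 5 * (ε / 5) := by ring
    _ = ε := ENNReal.mul_div_cancel (by norm_num) (by norm_num)

lemma isInducing_toL1Prod : IsInducing toL1Prod := by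
  refine isInducing_iff_nhds.2 fun T => le_antisymm ?_ ?_
  · exact (continuous_toL1Prod.tendsto T).le_comap
  · refine (setTendsto_of_tendsto_toL1 ?_).le_nhds
    exact (continuous_snd.tendsto (T.toL1Prod)).comp tendsto_comap

/-- Measurable limits of transformations and of their inverses are almost everywhere inverse. -/
lemma exists_of_tendsto_ae {S : ℕ → Aut01} {f g : unitInterval → unitInterval}
    (hf : Measurable f) (hg : Measurable g)
    (hSf : ∀ᵐ x, Tendsto (fun i => (S i).toEquiv x) atTop (𝓝 (f x)))
    (hSg : ∀ᵐ x, Tendsto (fun i => (S i).inv.toEquiv x) atTop (𝓝 (g x))) :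
    ∃ T : Aut01, T.toEquiv =ᵐ[volume] f ∧ T.toEquiv.symm =ᵐ[volume] g := by
  have hfi : Measurable fun x => (f x, x) := hf.prodMk measurable_id
  have hig : Measurable fun x => (x, g x) := measurable_id.prodMk hg
  have hmap : (volume.map fun x => (f x, x)) = volume.map fun x => (x, g x) := by
    have := Measure.isProbabilityMeasure_map (μ := (volume : Measure unitInterval)) hfi.aemeasurable
    have := Measure.isProbabilityMeasure_map (μ := (volume : Measure unitInterval)) hig.aemeasurable
    refine ext_of_forall_integral_eq_of_IsFiniteMeasure fun H => ?_
    have hH := H.continuous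
    rw [integral_map hfi.aemeasurable hH.aestronglyMeasurable,
      integral_map hig.aemeasurable hH.aestronglyMeasurable]
    have h1 : Tendsto (fun i => ∫ x, H ((S i).toEquiv x, x)) atTop (𝓝 (∫ x, H (f x, x))) := by
      refine tendsto_integral_of_dominated_convergence (fun _ => ‖H‖) (fun i => ?_)
        (integrable_const _) (fun i => Eventually.of_forall fun x => H.norm_coe_le_norm _) ?_
      · exact (hH.measurable.comp ((S i).measurePreserving_toFun.measurable.prodMk
          measurable_id)).aestronglyMeasurable
      · filter_upwards [hSf] with x hx
        exact (hH.tendsto _).comp (hx.prodMk_nhds tendsto_const_nhds)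
    have h2 : Tendsto (fun i => ∫ x, H (x, (S i).inv.toEquiv x)) atTop (𝓝 (∫ x, H (x, g x))) := by
      refine tendsto_integral_of_dominated_convergence (fun _ => ‖H‖) (fun i => ?_)
        (integrable_const _) (fun i => Eventually.of_forall fun x => H.norm_coe_le_norm _) ?_
      · exact (hH.measurable.comp (measurable_id.prodMk
          (S i).measurePreserving_invFun.measurable)).aestronglyMeasurable
      · filter_upwards [hSg] with x hx
        exact (hH.tendsto _).comp (tendsto_const_nhds.prodMk_nhds hx)
    refine tendsto_nhds_unique (h1.congr fun i => ?_) h2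
    have hm := (S i).measurePreserving_toFun
    have hmeas : Measurable fun x => H (x, (S i).inv.toEquiv x) :=
      hH.measurable.comp (measurable_id.prodMk (S i).measurePreserving_invFun.measurable)
    conv_rhs => rw [← hm.map_eq]
    rw [integral_map hm.measurable.aemeasurable hmeas.aestronglyMeasurable]
    refine integral_congr_ae (Eventually.of_forall fun x => ?_)
    simp [inv]
  have hfp : MeasurePreserving f volume volume := by
    refine ⟨hf, ?_⟩
    have := congrArg (Measure.map Prod.fst) hmap
    rw [Measure.map_map measurable_fst hfi, Measure.map_map measurable_fst hig] at this
    exact this.trans Measure.map_id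
  have hgp : MeasurePreserving g volume volume := by
    refine ⟨hg, ?_⟩
    have := congrArg (Measure.map Prod.snd) hmap
    rw [Measure.map_map measurable_snd hfi, Measure.map_map measurable_snd hig] at this
    exact this.symm.trans Measure.map_id
  refine exists_of_ae_inverse hfp hgp ?_ ?_
  · have hs : MeasurableSet {p : unitInterval × unitInterval | g p.1 = p.2} :=
      measurableSet_eq_fun (hg.comp measurable_fst) measurable_snd
    refine (ae_map_iff hfi.aemeasurable hs).1 ?_
    rw [hmap, ae_map_iff hig.aemeasurable hs]
    simp
  · have hs : MeasurableSet {p : unitInterval × unitInterval | f p.2 = p.1} :=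
      measurableSet_eq_fun (hf.comp measurable_snd) measurable_fst
    refine (ae_map_iff hig.aemeasurable hs).1 ?_
    rw [← hmap, ae_map_iff hfi.aemeasurable hs]
    simp

lemma isClosed_range_toL1Prod : IsClosed (Set.range toL1Prod) := by
  refine IsSeqClosed.isClosed fun u p hu hup => ?_
  choose S hS using hu
  obtain ⟨F, G⟩ := p
  have h1 : Tendsto (fun i => (S i).toL1) atTop (𝓝 F) := by
    simpa [← hS, Function.comp_def, toL1Prod] using (continuous_fst.tendsto _).comp hup
  have h2 : Tendsto (fun i => (S i).inv.toL1) atTop (𝓝 G) := by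
    simpa [← hS, Function.comp_def, toL1Prod] using (continuous_snd.tendsto _).comp hup
  obtain ⟨n, hn, hF⟩ := (tendstoInMeasure_of_tendsto_toL1 h1).exists_seq_tendsto_ae
  obtain ⟨m, hm, hG⟩ :=
    ((tendstoInMeasure_of_tendsto_toL1 h2).comp hn.tendsto_atTop).exists_seq_tendsto_ae
  have hproj : ∀ {a : ℕ → unitInterval} {b : ℝ}, Tendsto (fun i => (a i : ℝ)) atTop (𝓝 b) →
      Tendsto a atTop (𝓝 (Set.projIcc 0 1 zero_le_one b)) ∧
        (Set.projIcc 0 1 zero_le_one b : ℝ) = b := by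
    intro a b h
    have h' : Tendsto a atTop (𝓝 (Set.projIcc 0 1 zero_le_one b)) := by
      have := (continuous_projIcc (h := zero_le_one (α := ℝ))).continuousAt.tendsto.comp h
      simpa [Function.comp_def, Set.projIcc_val] using this
    exact ⟨h', tendsto_nhds_unique ((continuous_subtype_val.tendsto _).comp h') h⟩
  have hmeas : ∀ F : Lp ℝ 1 (volume : Measure unitInterval),
      Measurable fun x => Set.projIcc (0 : ℝ) 1 zero_le_one (F x) := fun F =>
    continuous_projIcc.measurable.comp (Lp.stronglyMeasurable F).measurable
  obtain ⟨T, hTf, hTg⟩ := exists_of_tendsto_ae (S := fun i => S (n (m i))) (hmeas F) (hmeas G)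
    (by filter_upwards [hF] with x hx using (hproj (hx.comp hm.tendsto_atTop)).1)
    (by filter_upwards [hG] with x hx using (hproj hx).1)
  refine ⟨T, Prod.ext (Lp.ext ?_) (Lp.ext ?_)⟩
  · filter_upwards [T.coeFn_toL1, hTf, hF] with x h1 h2 h3
    refine h1.trans ?_
    rw [h2]
    exact (hproj h3).2
  · filter_upwards [T.inv.coeFn_toL1, hTg, hG] with x h1 h2 h3
    refine h1.trans ?_
    change ((T.toEquiv.symm x : unitInterval) : ℝ) = _
    rw [h2]
    exact (hproj h3).2

instance : BaireSpace Aut01 := by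
  let m : PseudoMetricSpace Aut01 :=
    (PseudoMetricSpace.induced toL1Prod inferInstance).replaceTopology
      isInducing_toL1Prod.eq_induced
  have hu : IsUniformInducing toL1Prod := ⟨rfl⟩
  have hc : CompleteSpace Aut01 := hu.completeSpace isClosed_range_toL1Prod.isComplete
  infer_instance

instance : IsProbabilityMeasure (volume : Measure UnitAddCircle) := ⟨UnitAddCircle.measure_univ⟩

instance : NullSingletonClass (volume : Measure UnitAddCircle) := by
  refine ⟨fun x => ?_⟩
  have h := AddCircle.volume_closedBall (T := 1) (x := x) 0
  simpa using h

lemma integral_fourier_eq_zero {m : ℤ} (hm : m ≠ 0) :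
    ∫ y : UnitAddCircle, fourier m y = 0 := by
  refine integral_eq_zero_of_add_right_eq_neg (μ := (volume : Measure UnitAddCircle))
    (g := ((1 / 2 / m : ℝ) : UnitAddCircle)) fun y => ?_
  exact fourier_add_half_inv_index hm one_pos y

lemma integral_mFourier_eq_zero {N : ℕ} {m : Fin N → ℤ} (hm : m ≠ 0) :
    ∫ y : UnitAddTorus (Fin N), UnitAddTorus.mFourier m y = 0 := by
  obtain ⟨j, hj⟩ := Function.ne_iff.1 hm
  have := integral_fintype_prod_eq_prod (𝕜 := ℂ)
    (μ := fun _ : Fin N => (volume : Measure UnitAddCircle))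
    (fun (j : Fin N) (y : UnitAddCircle) => fourier (m j) y)
  refine this.trans (Finset.prod_eq_zero (Finset.mem_univ j) (integral_fourier_eq_zero hj))

/-- The point of the torus with coordinates `k j * x`. -/
def torusLine {N : ℕ} (k : Fin N → ℤ) (x : ℝ) : UnitAddTorus (Fin N) :=
  fun j => (((k j : ℝ) * x : ℝ) : UnitAddCircle)

lemma continuous_torusLine {N : ℕ} (k : Fin N → ℤ) : Continuous (torusLine k) :=
  continuous_pi fun _ => (AddCircle.continuous_mk' 1).comp (continuous_const.mul continuous_id)

lemma mFourier_torusLine {N : ℕ} (m k : Fin N → ℤ) (x : ℝ) :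
    UnitAddTorus.mFourier m (torusLine k x) =
      Complex.exp (2 * Real.pi * Complex.I * ((∑ j, m j * k j : ℤ) : ℂ) * x) := by
  simp only [UnitAddTorus.mFourier, ContinuousMap.coe_mk, torusLine, fourier_coe_apply]
  rw [← Complex.exp_sum]
  congr 1
  push_cast
  rw [Finset.mul_sum, Finset.sum_mul]
  refine Finset.sum_congr rfl fun j _ => ?_
  ring

lemma norm_integral_exp_le {a b : ℝ} {k : ℤ} (hk : k ≠ 0) :
    ‖∫ x in a..b, Complex.exp (2 * Real.pi * Complex.I * (k : ℂ) * x)‖ ≤ 1 / (|(k : ℝ)|) := by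
  have hk' : (0 : ℝ) < |(k : ℝ)| := abs_pos.2 (Int.cast_ne_zero.2 hk)
  have hc : 2 * Real.pi * Complex.I * (k : ℂ) ≠ 0 := by
    simp [hk, Real.pi_ne_zero]
  rw [integral_exp_mul_complex hc, norm_div]
  have h1 : ∀ x : ℝ, ‖Complex.exp (2 * Real.pi * Complex.I * (k : ℂ) * x)‖ = 1 := by
    intro x
    rw [← Complex.norm_exp_ofReal_mul_I (2 * Real.pi * k * x)]
    congr 2
    push_cast
    ring
  have h2 : ‖2 * Real.pi * Complex.I * (k : ℂ)‖ = 2 * Real.pi * |(k : ℝ)| := by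
    simp [abs_of_pos Real.pi_pos]
  rw [h2, div_le_div_iff₀ (by positivity) hk']
  have h3 := norm_sub_le (Complex.exp (2 * Real.pi * Complex.I * (k : ℂ) * b))
    (Complex.exp (2 * Real.pi * Complex.I * (k : ℂ) * a))
  rw [h1, h1] at h3
  nlinarith [Real.pi_gt_three]

section Equidistribution

variable {N : ℕ} {v : Fin N → Polynomial ℤ}

lemma tendsto_abs_sum_mul_eval
    (hli : ∀ a : Fin N → ℤ, ∑ j, Polynomial.C (a j) * v j = 0 → a = 0)
    (h0 : ∀ j, (v j).eval 0 = 0) {m : Fin N → ℤ} (hm : m ≠ 0) :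
    Tendsto (fun n : ℕ => |((∑ j, m j * (v j).eval (n : ℤ) : ℤ) : ℝ)|) atTop atTop := by
  set P : Polynomial ℤ := ∑ j, Polynomial.C (m j) * v j with hP
  have hP0 : P ≠ 0 := fun h => hm (hli m h)
  have hPe : P.eval 0 = 0 := by simp [hP, Polynomial.eval_finsetSum, h0]
  have hdeg : 0 < P.degree := by
    rw [← not_le]
    intro h
    rw [Polynomial.eq_C_of_degree_le_zero h, Polynomial.eval_C] at hPe
    exact hP0 (by rw [Polynomial.eq_C_of_degree_le_zero h, hPe, Polynomial.C_0])
  have hdeg' : 0 < (P.map (Int.castRingHom ℝ)).degree := by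
    rwa [Polynomial.degree_map_eq_of_injective Int.cast_injective]
  refine ((Polynomial.abs_tendsto_atTop _ hdeg').comp tendsto_natCast_atTop_atTop).congr
    fun n => ?_
  have : (P.map (Int.castRingHom ℝ)).eval ((n : ℤ) : ℝ) = ((P.eval (n : ℤ) : ℤ) : ℝ) := by
    rw [← eq_intCast (Int.castRingHom ℝ) (n : ℤ), Polynomial.eval_map_apply, eq_intCast]
  rw [Function.comp_apply, ← Int.cast_natCast (R := ℝ) n, this, hP, Polynomial.eval_finsetSum]
  simp

/-- Weyl's equidistribution of the polynomial curve, averaged over an interval of slopes. -/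
lemma tendsto_integral_torusLine
    (hli : ∀ a : Fin N → ℤ, ∑ j, Polynomial.C (a j) * v j = 0 → a = 0)
    (h0 : ∀ j, (v j).eval 0 = 0) {a b : ℝ} (hab : a < b) (F : C(UnitAddTorus (Fin N), ℂ)) :
    Tendsto (fun n : ℕ => ∫ x in a..b, F (torusLine (fun j => (v j).eval (n : ℤ)) x)) atTop
      (𝓝 ((b - a) * ∫ y, F y)) := by
  have hF : F ∈ (Submodule.span ℂ (Set.range
      (UnitAddTorus.mFourier (d := Fin N)))).topologicalClosure := by
    rw [UnitAddTorus.span_mFourier_closure_eq_top]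
    trivial
  have hInt : ∀ (G : C(UnitAddTorus (Fin N), ℂ)) (n : ℕ), IntervalIntegrable
      (fun x => G (torusLine (fun j => (v j).eval (n : ℤ)) x)) volume a b := fun G n =>
    (G.continuous.comp (continuous_torusLine _)).intervalIntegrable _ _
  have hInt' : ∀ G : C(UnitAddTorus (Fin N), ℂ), Integrable G volume := fun G =>
    G.continuous.integrable_of_hasCompactSupport (HasCompactSupport.of_compactSpace G)
  have hspan : ∀ G ∈ Submodule.span ℂ (Set.range (UnitAddTorus.mFourier (d := Fin N))),
      Tendsto (fun n : ℕ => ∫ x in a..b, G (torusLine (fun j => (v j).eval (n : ℤ)) x)) atTop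
      (𝓝 ((b - a) * ∫ y, G y)) := by
    intro G hG
    induction hG using Submodule.span_induction with
    | mem G hG =>
      obtain ⟨m, rfl⟩ := hG
      by_cases hm : m = 0
      · subst hm
        simp [UnitAddTorus.mFourier_zero]
      · rw [integral_mFourier_eq_zero hm, mul_zero]
        have hk := tendsto_abs_sum_mul_eval hli h0 hm
        simp only [mFourier_torusLine]
        refine squeeze_zero_norm' ?_ (hk.inv_tendsto_atTop)
        filter_upwards [hk.eventually_gt_atTop 0] with n hn
        refine (norm_integral_exp_le ?_).trans (by simp)
        intro h
        simp [h] at hn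
    | zero => simp
    | add G H _ _ hG hH =>
      refine (hG.add hH).congr' ?_ |>.trans (le_of_eq ?_)
      · refine Eventually.of_forall fun n => ?_
        exact (intervalIntegral.integral_add (hInt G n) (hInt H n)).symm
      · rw [← mul_add, ← integral_add (hInt' G) (hInt' H)]
        rfl
    | smul c G _ hG =>
      refine (hG.const_mul c).congr' ?_ |>.trans (le_of_eq ?_)
      · refine Eventually.of_forall fun n => ?_
        simp [intervalIntegral.integral_const_mul]
      · simp only [ContinuousMap.coe_smul, Pi.smul_apply, smul_eq_mul, integral_const_mul]
        congr 1
        ring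
  rw [Metric.tendsto_atTop]
  intro ε hε
  have hba : 0 < b - a := sub_pos.2 hab
  obtain ⟨G, hG, hFG⟩ := Metric.mem_closure_iff.1 hF (ε / (3 * (b - a))) (by positivity)
  obtain ⟨n₀, hn₀⟩ := Metric.tendsto_atTop.1 (hspan G hG) (ε / 3) (by positivity)
  have hb : ∀ y, ‖F y - G y‖ ≤ ε / (3 * (b - a)) := fun y => by
    rw [← dist_eq_norm]
    exact (ContinuousMap.dist_apply_le_dist y).trans hFG.le
  have he : ε / (3 * (b - a)) * (b - a) = ε / 3 := by field_simp
  refine ⟨n₀, fun n hn => ?_⟩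
  have h1 : dist (∫ x in a..b, F (torusLine (fun j => (v j).eval (n : ℤ)) x))
      (∫ x in a..b, G (torusLine (fun j => (v j).eval (n : ℤ)) x)) ≤ ε / 3 := by
    rw [dist_eq_norm, ← intervalIntegral.integral_sub (hInt F n) (hInt G n), ← he]
    refine (intervalIntegral.norm_integral_le_of_norm_le_const fun x _ => hb _).trans ?_
    rw [abs_of_pos hba]
  have h2 : dist ((b - a) * ∫ y, G y) ((b - a) * ∫ y, F y : ℂ) ≤ ε / 3 := by
    rw [dist_comm, dist_eq_norm, ← mul_sub, ← integral_sub (hInt' F) (hInt' G), norm_mul,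
      ← Complex.ofReal_sub, Complex.norm_real, Real.norm_of_nonneg hba.le, ← he, mul_comm]
    refine mul_le_mul_of_nonneg_right ?_ hba.le
    refine (norm_integral_le_of_norm_le_const (Eventually.of_forall hb)).trans ?_
    simp
  calc _ ≤ _ + _ + _ := dist_triangle4 _ (∫ x in a..b, G (torusLine (fun j =>
        (v j).eval (n : ℤ)) x)) ((b - a) * ∫ y, G y) _
    _ < ε / 3 + ε / 3 + ε / 3 := by
      have := hn₀ n hn
      linarith
    _ = ε := by ring

/-- The polynomial curves are eventually dense at any scale, with slopes in a given interval. -/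
lemma eventually_exists_torusLine_near
    (hli : ∀ a : Fin N → ℤ, ∑ j, Polynomial.C (a j) * v j = 0 → a = 0)
    (h0 : ∀ j, (v j).eval 0 = 0) {a b : ℝ} (hab : a < b) (t : UnitAddTorus (Fin N))
    {η : ℝ} (hη : 0 < η) :
    ∀ᶠ n : ℕ in atTop, ∃ x ∈ Set.Icc a b,
      dist (torusLine (fun j => (v j).eval (n : ℤ)) x) t < η := by
  have hc : Continuous fun y : UnitAddTorus (Fin N) => max 0 (η - dist y t) := by fun_prop
  let F : C(UnitAddTorus (Fin N), ℂ) :=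
    ⟨fun y => ((max 0 (η - dist y t) : ℝ) : ℂ), Complex.continuous_ofReal.comp hc⟩
  have hpos : 0 < ∫ y, max 0 (η - dist y t) := by
    refine hc.integral_pos_of_hasCompactSupport_nonneg_nonzero
      (HasCompactSupport.of_compactSpace _) (fun y => le_max_left _ _) (x := t) ?_
    simp [hη.le, hη.ne']
  have hne : ((b - a) * ∫ y, F y : ℂ) ≠ 0 := by
    refine mul_ne_zero ?_ ?_
    · exact_mod_cast (sub_pos.2 hab).ne'
    · change ∫ y, ((max 0 (η - dist y t) : ℝ) : ℂ) ≠ 0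
      rw [integral_complex_ofReal]
      exact_mod_cast hpos.ne'
  filter_upwards [(tendsto_integral_torusLine hli h0 hab F).eventually_ne hne] with n hn
  by_contra! hcon
  refine hn (intervalIntegral.integral_zero_ae (Eventually.of_forall fun x hx => ?_))
  rw [Set.uIoc_of_le hab.le] at hx
  have := hcon x (Set.Ioc_subset_Icc_self hx)
  change ((max 0 (η - dist _ t) : ℝ) : ℂ) = 0
  rw [max_eq_left (by linarith), Complex.ofReal_zero]

end Equidistribution

lemma measurePreserving_perm_zpow {W : Type*} [MeasurableSpace W] {ν : Measure W}
    {R : Equiv.Perm W} (hR : MeasurePreserving R ν ν) (hR' : MeasurePreserving R.symm ν ν)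
    (m : ℤ) : MeasurePreserving ⇑(R ^ m) ν ν := by
  have hpow : ∀ {Q : Equiv.Perm W}, MeasurePreserving Q ν ν → ∀ n : ℕ,
      MeasurePreserving ⇑(Q ^ n) ν ν := fun hQ n => by
    rw [Equiv.Perm.coe_pow]
    exact hQ.iterate n
  cases m with
  | ofNat n => simpa using hpow hR n
  | negSucc n =>
    have h := hpow (Q := R⁻¹) hR' (n + 1)
    simpa [zpow_negSucc, ← inv_pow] using h

/-- An invertible system can be moved to the unit interval, in such a way that finitely many
sets pulled back by a factor map are preserved. -/
lemma exists_transport {W : Type*} [MeasurableSpace W] [StandardBorelSpace W] {ν : Measure W}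
    [IsProbabilityMeasure ν] [NullSingletonClass ν] {Ψ : W → unitInterval}
    (hΨ : MeasurePreserving Ψ ν volume) {R : Equiv.Perm W} (hR : MeasurePreserving R ν ν)
    (hR' : MeasurePreserving R.symm ν ν) {ι : Type*} [Finite ι] {A : ι → Set unitInterval}
    (hA : ∀ i, MeasurableSet (A i)) :
    ∃ S : Aut01,
      (∀ m i i', S.corr m (A i) (A i') = (ν {w | Ψ w ∈ A i ∧ Ψ ((R ^ m) w) ∈ A i'}).toReal) ∧
      ∀ i i', volume ((S.toEquiv '' A i) ∆ A i') =
        ν ({w | Ψ w ∈ A i} ∆ {w | Ψ (R w) ∈ A i'}) := by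
  obtain ⟨θ, ψ, hθ, hψ, hψθ, hθψ, hAθ⟩ := exists_iso_preimage_ae_eq hΨ hA
  obtain ⟨S, hS, -⟩ := exists_of_ae_inverse (f := θ ∘ R ∘ ψ) (g := θ ∘ R.symm ∘ ψ)
    (hθ.comp (hR.comp hψ)) (hθ.comp (hR'.comp hψ))
    (by
      filter_upwards [(hR.comp hψ).quasiMeasurePreserving.ae hψθ, hθψ] with t h1 h2
      simp only [Function.comp_apply] at h1 ⊢
      rw [h1, Equiv.symm_apply_apply, h2])
    (by
      filter_upwards [(hR'.comp hψ).quasiMeasurePreserving.ae hψθ, hθψ] with t h1 h2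
      simp only [Function.comp_apply] at h1 ⊢
      rw [h1, Equiv.apply_symm_apply, h2])
  have hconj : ∀ᵐ w ∂ν, S.toEquiv (θ w) = θ (R w) := by
    filter_upwards [hθ.quasiMeasurePreserving.ae hS, hψθ] with w h1 h2
    rw [h1]
    simp only [Function.comp_apply]
    rw [h2]
  have hpow := fun m => zpow_conj_ae hR hR' hconj m
  refine ⟨S, fun m i i' => ?_, fun i i' => ?_⟩
  · have hm : MeasurableSet (A i ∩ ⇑(S.toEquiv ^ m : Equiv.Perm unitInterval) ⁻¹' A i') :=
      (hA i).inter ((S.measurePreserving_zpow m).measurable (hA i'))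
    rw [corr, ← hθ.measure_preimage hm.nullMeasurableSet]
    congr 1
    refine measure_congr ?_
    filter_upwards [hpow m, hAθ,
      (measurePreserving_perm_zpow hR hR' m).quasiMeasurePreserving.ae hAθ] with w h1 h2 h3
    refine propext ?_
    change (θ w ∈ A i ∧ (S.toEquiv ^ m) (θ w) ∈ A i') ↔ (Ψ w ∈ A i ∧ Ψ ((R ^ m) w) ∈ A i')
    rw [h1, h2, h3]
  · have hm : MeasurableSet ((S.toEquiv '' A i) ∆ A i') :=
      (S.measurableSet_image (hA i)).symmDiff (hA i')
    rw [← (S.measurePreserving_toFun.comp hθ).measure_preimage hm.nullMeasurableSet]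
    refine measure_congr ?_
    filter_upwards [hconj, hAθ, hR.quasiMeasurePreserving.ae hAθ] with w h1 h2 h3
    refine propext ?_
    have h4 : S.toEquiv (θ w) ∈ S.toEquiv '' A i ↔ Ψ w ∈ A i := by
      rw [S.toEquiv.injective.mem_set_image, h2]
    have h5 : S.toEquiv (θ w) ∈ A i' ↔ Ψ (R w) ∈ A i' := by rw [h1, h3]
    change (S.toEquiv (θ w) ∈ (S.toEquiv '' A i) ∆ A i') ↔
      w ∈ {w | Ψ w ∈ A i} ∆ {w | Ψ (R w) ∈ A i'}
    rw [Set.mem_symmDiff, Set.mem_symmDiff, h4, h5]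
    rfl

/-- The factor map of a tower of height `R` over a base isomorphic to the unit interval. -/
lemma measurePreserving_tower (T : Aut01) {W : Type*} [MeasurableSpace W] {ν : Measure W}
    [IsProbabilityMeasure ν] {τ : W → W} (hτ : MeasurePreserving τ ν ν) {R : ℕ} (hR : 0 < R)
    {k : W → ℕ} (hk : Measurable k) (hkR : ∀ w, k w < R)
    (hkτ : ∀ w, k (τ w) = if k w + 1 < R then k w + 1 else 0) {u : W → unitInterval}
    (hu : MeasurePreserving u ν volume) (huτ : ∀ w, u (τ w) = u w) :
    MeasurePreserving (fun w => (T.toEquiv ^ (k w) : Equiv.Perm unitInterval) (u w)) ν volume ∧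
      ν {w | ¬ k w + 1 < R} = 1 / R := by
  have hfib : ∀ s : Set W, MeasurableSet s →
      ν s = ∑ i ∈ Finset.range R, ν ({w | k w = i} ∩ s) := by
    intro s hs
    have hun : s = ⋃ i ∈ Finset.range R, ({w | k w = i} ∩ s) := by
      ext w
      simp only [Set.mem_iUnion, Finset.mem_range, Set.mem_inter_iff]
      exact ⟨fun h => ⟨k w, hkR w, rfl, h⟩, fun ⟨_, _, _, h⟩ => h⟩
    conv_lhs => rw [hun]
    refine measure_biUnion_finset ?_ fun i _ => (hk (measurableSet_singleton i)).inter hs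
    intro i _ j _ hij
    exact Set.disjoint_left.2 fun w hw hw' => hij (hw.1.symm.trans hw'.1)
  have hstep : ∀ E, MeasurableSet E → ∀ i, i < R →
      ν ({w | k w = i} ∩ u ⁻¹' E) = ν ({w | k w = 0} ∩ u ⁻¹' E) := by
    intro E hE i
    induction i with
    | zero => intro _; rfl
    | succ i ih =>
      intro hi
      have hm : MeasurableSet ({w | k w = i + 1} ∩ u ⁻¹' E) :=
        (hk (measurableSet_singleton _)).inter (hu.measurable hE)
      rw [← ih (by omega), ← hτ.measure_preimage hm.nullMeasurableSet]
      congr 1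
      ext w
      have h1 := hkτ w
      simp only [Set.mem_preimage, Set.mem_inter_iff, Set.mem_ofPred_eq, huτ]
      split_ifs at h1 with h2 <;> rw [h1] <;> constructor <;> rintro ⟨h3, h4⟩ <;>
        refine ⟨?_, h4⟩ <;> omega
  have hlevel : ∀ E, MeasurableSet E → ∀ i, i < R →
      ν ({w | k w = i} ∩ u ⁻¹' E) = volume E / R := by
    intro E hE i hi
    have h := hfib _ (hu.measurable hE)
    rw [Finset.sum_congr rfl fun j hj => hstep E hE j (Finset.mem_range.1 hj),
      Finset.sum_const, Finset.card_range, nsmul_eq_mul,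
      hu.measure_preimage hE.nullMeasurableSet] at h
    rw [hstep E hE i hi, ENNReal.eq_div_iff (by simpa using hR.ne') (by simp), h]
  have hmeas : Measurable fun w => (T.toEquiv ^ (k w) : Equiv.Perm unitInterval) (u w) :=
    (measurable_from_prod_countable_right (f := fun p : ℕ × unitInterval =>
      (T.toEquiv ^ p.1 : Equiv.Perm unitInterval) p.2)
      fun n => (T.measurePreserving_pow n).measurable).comp (hk.prodMk hu.measurable)
  refine ⟨⟨hmeas, ?_⟩, ?_⟩
  · ext D hD
    have hTD : ∀ i : ℕ, MeasurableSet ((T.toEquiv ^ i : Equiv.Perm unitInterval) ⁻¹' D) :=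
      fun i => (T.measurePreserving_pow i).measurable hD
    have hpiece : ∀ i ∈ Finset.range R, ν ({w | k w = i} ∩
        (fun w => (T.toEquiv ^ (k w) : Equiv.Perm unitInterval) (u w)) ⁻¹' D) =
        volume D / R := by
      intro i hi
      rw [← (T.measurePreserving_pow i).measure_preimage hD.nullMeasurableSet,
        ← hlevel _ (hTD i) i (Finset.mem_range.1 hi)]
      congr 1
      ext w
      constructor <;> rintro ⟨h1, h2⟩ <;> refine ⟨h1, ?_⟩ <;>
        simp only [Set.mem_ofPred_eq] at h1 <;>
        simpa only [Set.mem_preimage, h1] using h2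
    rw [Measure.map_apply hmeas hD, hfib _ (hmeas hD), Finset.sum_congr rfl hpiece,
      Finset.sum_const, Finset.card_range, nsmul_eq_mul]
    exact ENNReal.mul_div_cancel (by simpa using hR.ne') (by simp)
  · have h := hlevel Set.univ MeasurableSet.univ (R - 1) (by omega)
    rw [measure_univ] at h
    rw [← h]
    congr 1
    ext w
    have := hkR w
    simp only [Set.mem_ofPred_eq, Set.preimage_univ, Set.inter_univ]
    omega

/-- The representative in `[0,1)` of a point of the circle. -/
def circleRep (y : UnitAddCircle) : unitInterval :=
  ⟨AddCircle.equivIco 1 0 y, (AddCircle.equivIco 1 0 y).2.1,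
    by simpa using (AddCircle.equivIco 1 0 y).2.2.le⟩

lemma circleRep_lt_one (y : UnitAddCircle) : (circleRep y : ℝ) < 1 :=
  lt_of_lt_of_eq (AddCircle.equivIco 1 0 y).2.2 (zero_add 1)

lemma coe_circleRep (y : UnitAddCircle) : ((circleRep y : ℝ) : UnitAddCircle) = y :=
  (AddCircle.equivIco 1 0).symm_apply_apply y

lemma circleRep_coe (x : ℝ) : (circleRep (x : UnitAddCircle) : ℝ) = Int.fract x := by
  change ((AddCircle.equivIco 1 0 (x : UnitAddCircle) : Set.Ico (0 : ℝ) (0 + 1)) : ℝ) = _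
  rw [AddCircle.coe_equivIco_mk_apply, div_one, mul_one]

lemma measurable_circleRep : Measurable circleRep :=
  (measurable_subtype_coe.comp (AddCircle.measurableEquivIco 1 0).measurable).subtype_mk

lemma measurePreserving_circleRep : MeasurePreserving circleRep volume volume := by
  have hq : MeasurePreserving (fun t : unitInterval => ((t : ℝ) : UnitAddCircle))
      volume volume := by
    have h1 : MeasurePreserving (Subtype.val : unitInterval → ℝ) volume
        (volume.restrict (Set.Ioc 0 (0 + 1))) := by
      rw [zero_add, restrict_Ioc_eq_restrict_Icc]
      exact measurePreserving_subtype_coe measurableSet_Icc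
    exact (UnitAddCircle.measurePreserving_mk 0).comp h1
  refine ⟨measurable_circleRep, ?_⟩
  rw [← hq.map_eq, Measure.map_map measurable_circleRep hq.measurable]
  have hne : ∀ᵐ t : unitInterval, t ≠ 1 := by simp [ae_iff]
  refine (Measure.map_congr (g := id) ?_).trans Measure.map_id
  filter_upwards [hne] with t ht
  refine Subtype.ext ?_
  rw [Function.comp_apply, circleRep_coe, Int.fract_eq_self.2
    ⟨t.2.1, lt_of_le_of_ne t.2.2 fun h => ht (Subtype.ext h)⟩, id]

lemma dist_coe_le (x y : ℝ) : dist (x : UnitAddCircle) (y : UnitAddCircle) ≤ |x - y| := by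
  rw [dist_eq_norm, ← AddCircle.coe_sub]
  exact QuotientAddGroup.norm_mk_le_norm

/-- The index of the interval of length `1 / R` containing a point of the circle. -/
def circleIndex (R : ℕ) (y : UnitAddCircle) : ℕ := ⌊(R : ℝ) * circleRep y⌋₊

lemma measurable_circleIndex (R : ℕ) : Measurable (circleIndex R) :=
  Nat.measurable_floor.comp
    (measurable_const.mul (measurable_subtype_coe.comp measurable_circleRep))

lemma circleIndex_lt {R : ℕ} (hR : 0 < R) (y : UnitAddCircle) : circleIndex R y < R := by
  have hR' : (0 : ℝ) < R := by exact_mod_cast hR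
  rw [circleIndex, Nat.floor_lt (mul_nonneg hR'.le (circleRep y).2.1)]
  nlinarith [circleRep_lt_one y]

lemma dist_circleIndex_le {R : ℕ} (hR : 0 < R) (y : UnitAddCircle) :
    dist (((circleIndex R y / R : ℝ)) : UnitAddCircle) y ≤ 1 / R := by
  have hR' : (0 : ℝ) < R := by exact_mod_cast hR
  have h1 := Nat.floor_le (mul_nonneg hR'.le (circleRep y).2.1)
  have h2 := Nat.lt_floor_add_one ((R : ℝ) * circleRep y)
  conv_lhs => rw [← coe_circleRep y]
  refine (dist_coe_le _ _).trans ?_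
  rw [coe_circleRep, abs_le, ← neg_div, div_sub' hR'.ne', div_le_div_iff_of_pos_right hR',
    div_le_div_iff_of_pos_right hR']
  change -1 ≤ ((⌊(R : ℝ) * circleRep y⌋₊ : ℕ) : ℝ) - _ ∧
    ((⌊(R : ℝ) * circleRep y⌋₊ : ℕ) : ℝ) - _ ≤ 1
  constructor <;> linarith

lemma circleIndex_add {R : ℕ} (hR : 0 < R) (y : UnitAddCircle) :
    circleIndex R (y + ((1 / R : ℝ) : UnitAddCircle)) =
      if circleIndex R y + 1 < R then circleIndex R y + 1 else 0 := by
  have hR' : (0 : ℝ) < R := by exact_mod_cast hR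
  have h0 := (circleRep y).2.1
  have h1 := circleRep_lt_one y
  have h2 := Nat.floor_le (mul_nonneg hR'.le h0)
  have h3 := Nat.lt_floor_add_one ((R : ℝ) * circleRep y)
  have h4 : R * (1 / R : ℝ) = 1 := by field_simp
  have hpos : (0 : ℝ) < 1 / R := by positivity
  have hle : (1 : ℝ) / R ≤ 1 := by
    rw [div_le_one hR']
    exact_mod_cast hR
  have hrep : (circleRep (y + ((1 / R : ℝ) : UnitAddCircle)) : ℝ) =
      Int.fract ((circleRep y : ℝ) + 1 / R) := by
    conv_lhs => rw [← coe_circleRep y, ← AddCircle.coe_add]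
    rw [circleRep_coe]
  change ⌊(R : ℝ) * circleRep (y + ((1 / R : ℝ) : UnitAddCircle))⌋₊ =
    if ⌊(R : ℝ) * circleRep y⌋₊ + 1 < R then ⌊(R : ℝ) * circleRep y⌋₊ + 1 else 0
  rw [hrep]
  split_ifs with h
  · have h5 : ((⌊(R : ℝ) * circleRep y⌋₊ : ℕ) : ℝ) + 2 ≤ R := by exact_mod_cast h
    rw [Int.fract_eq_self.2 ⟨by linarith, by nlinarith⟩, mul_add, h4,
      Nat.floor_add_one (mul_nonneg hR'.le h0)]
  · have h5 : (R : ℝ) ≤ ((⌊(R : ℝ) * circleRep y⌋₊ : ℕ) : ℝ) + 1 := by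
      exact_mod_cast not_lt.1 h
    have h6 : Int.fract ((circleRep y : ℝ) + 1 / R) = (circleRep y : ℝ) + 1 / R - 1 := by
      rw [Int.fract_eq_iff]
      exact ⟨by nlinarith, by linarith, 1, by simp⟩
    rw [h6, Nat.floor_eq_zero]
    nlinarith

/-- The factor map from the circle that turns the rotation by `1 / R` into `T`, off a small
set. -/
def circleTower (T : Aut01) (R : ℕ) (y : UnitAddCircle) : unitInterval :=
  (T.toEquiv ^ circleIndex R y : Equiv.Perm unitInterval) (circleRep (R • y))

lemma nsmul_add_one_div {R : ℕ} (hR : 0 < R) (y : UnitAddCircle) :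
    R • (y + ((1 / R : ℝ) : UnitAddCircle)) = R • y := by
  have hR' : (R : ℝ) ≠ 0 := by exact_mod_cast hR.ne'
  rw [nsmul_add, ← AddCircle.coe_nsmul, nsmul_eq_mul, mul_one_div_cancel hR',
    AddCircle.coe_period, add_zero]

lemma measurePreserving_circleTower (T : Aut01) {R : ℕ} (hR : 1 < R) :
    MeasurePreserving (circleTower T R) volume volume ∧
      volume {y : UnitAddCircle | ¬ circleIndex R y + 1 < R} = 1 / R :=
  T.measurePreserving_tower (measurePreserving_add_right volume ((1 / R : ℝ) : UnitAddCircle))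
    (by omega) (measurable_circleIndex R) (circleIndex_lt (by omega)) (circleIndex_add (by omega))
    (measurePreserving_circleRep.comp (AddCircle.ergodic_nsmul hR).toMeasurePreserving)
    fun y => congrArg circleRep (nsmul_add_one_div (by omega) y)

lemma circleTower_add (T : Aut01) {R : ℕ} (hR : 0 < R) {y : UnitAddCircle}
    (hy : circleIndex R y + 1 < R) :
    circleTower T R (y + ((1 / R : ℝ) : UnitAddCircle)) = T.toEquiv (circleTower T R y) := by
  rw [circleTower, circleTower, circleIndex_add hR, if_pos hy, nsmul_add_one_div hR, pow_succ',
    Equiv.Perm.mul_apply]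

lemma tendsto_measure_symmDiff_add {B : Set UnitAddCircle} (hB : MeasurableSet B)
    (c : UnitAddCircle) : Tendsto
      (fun t => volume (((fun y => y + t) ⁻¹' B) ∆ ((fun y => y + c) ⁻¹' B))) (𝓝 c) (𝓝 0) := by
  let F : C(UnitAddCircle × UnitAddCircle, UnitAddCircle) := ⟨fun p => p.2 + p.1, by fun_prop⟩
  exact tendsto_measure_symmDiff_preimage_nhds_zero (f := fun t => F.curry t) (g := F.curry c)
    (F.curry.continuous.tendsto c)
    (Eventually.of_forall fun t => measurePreserving_add_right volume t)
    (measurePreserving_add_right volume c) hB.nullMeasurableSet (measure_ne_top _ _)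

/-- Correlations of rotations. -/
def rotCorr (B B' : Set UnitAddCircle) (t : UnitAddCircle) : ℝ :=
  (volume (B ∩ (fun y => y + t) ⁻¹' B')).toReal

lemma continuous_rotCorr (B : Set UnitAddCircle) {B' : Set UnitAddCircle}
    (hB' : MeasurableSet B') : Continuous (rotCorr B B') := by
  rw [continuous_iff_continuousAt]
  intro c
  have h := (ENNReal.tendsto_toReal ENNReal.zero_ne_top).comp (tendsto_measure_symmDiff_add hB' c)
  rw [ENNReal.toReal_zero] at h
  rw [ContinuousAt, tendsto_iff_dist_tendsto_zero]
  refine squeeze_zero (fun _ => dist_nonneg) (fun t => ?_) h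
  rw [Real.dist_eq, rotCorr, rotCorr]
  refine (abs_toReal_sub_le _ _).trans (ENNReal.toReal_mono (measure_ne_top _ _)
    (measure_mono ?_))
  rw [← Set.inter_symmDiff_distrib_left]
  exact Set.inter_subset_right

lemma integral_rotCorr {B B' : Set UnitAddCircle} (hB : MeasurableSet B)
    (hB' : MeasurableSet B') :
    ∫ t, rotCorr B B' t = (volume B).toReal * (volume B').toReal := by
  have hm : MeasurableSet {p : UnitAddCircle × UnitAddCircle | p.2 ∈ B ∧ p.2 + p.1 ∈ B'} :=
    (measurable_snd hB).inter ((measurable_snd.add measurable_fst) hB')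
  have h1 : ∀ y : UnitAddCircle, volume {t : UnitAddCircle | y ∈ B ∧ y + t ∈ B'} =
      B.indicator (fun _ => volume B') y := fun y => by
    by_cases hy : y ∈ B
    · simp only [hy, true_and, Set.indicator_of_mem]
      exact measure_preimage_add volume y B'
    · simp [hy]
  have h2 : ∫⁻ t : UnitAddCircle, volume (B ∩ (fun y => y + t) ⁻¹' B') =
      volume B * volume B' := by
    refine (Measure.prod_apply (μ := volume) (ν := volume) hm).symm.trans ?_
    rw [Measure.prod_apply_symm hm]
    refine (lintegral_congr h1).trans ?_
    rw [lintegral_indicator_const hB, mul_comm]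
  rw [← ENNReal.toReal_mul, ← h2]
  refine integral_toReal ?_ (Eventually.of_forall fun _ => measure_lt_top _ _)
  exact (measurable_measure_prodMk_left hm).aemeasurable

/-- The skew product `(z, y) ↦ (z, y + x z)`. -/
def skew (x : UnitAddCircle → UnitAddCircle) : Equiv.Perm (UnitAddCircle × UnitAddCircle) where
  toFun p := (p.1, p.2 + x p.1)
  invFun p := (p.1, p.2 - x p.1)
  left_inv p := by simp
  right_inv p := by simp

lemma skew_zpow_apply (x : UnitAddCircle → UnitAddCircle) (m : ℤ)
    (p : UnitAddCircle × UnitAddCircle) : (skew x ^ m) p = (p.1, p.2 + m • x p.1) := by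
  let φ : Multiplicative (UnitAddCircle → UnitAddCircle) →*
      Equiv.Perm (UnitAddCircle × UnitAddCircle) :=
    { toFun := fun x => skew x.toAdd
      map_one' := by ext p <;> simp [skew]
      map_mul' := fun x x' => by
        refine Equiv.ext fun p => Prod.ext rfl ?_
        change p.2 + (x.toAdd p.1 + x'.toAdd p.1) = p.2 + x'.toAdd p.1 + x.toAdd p.1
        abel }
  have h : skew x ^ m = skew (m • x) := (map_zpow φ (Multiplicative.ofAdd x) m).symm
  rw [h]
  rfl

lemma measurePreserving_skew {x : UnitAddCircle → UnitAddCircle} (hx : Measurable x) :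
    MeasurePreserving (skew x) (volume.prod volume) (volume.prod volume) :=
  (MeasurePreserving.id volume).skew_product
    (g := fun z y => y + x z) (measurable_snd.add (hx.comp measurable_fst))
    (Eventually.of_forall fun z => (measurePreserving_add_right volume (x z)).map_eq)

lemma toReal_measure_skew {x : UnitAddCircle → UnitAddCircle} (hx : Measurable x) (m : ℤ)
    {B B' : Set UnitAddCircle} (hB : MeasurableSet B) (hB' : MeasurableSet B') :
    ((volume.prod volume : Measure (UnitAddCircle × UnitAddCircle))
      {w | w.2 ∈ B ∧ ((skew x ^ m) w).2 ∈ B'}).toReal = ∫ z, rotCorr B B' (m • x z) := by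
  simp only [skew_zpow_apply]
  have hm : MeasurableSet {w : UnitAddCircle × UnitAddCircle |
      w.2 ∈ B ∧ w.2 + m • x w.1 ∈ B'} :=
    (measurable_snd hB).inter
      ((measurable_snd.add ((hx.comp measurable_fst).const_smul m)) hB')
  rw [Measure.prod_apply hm]
  exact (integral_toReal (measurable_measure_prodMk_left hm).aemeasurable
    (Eventually.of_forall fun _ => measure_lt_top _ _)).symm

lemma rotCorr_le_one (B B' : Set UnitAddCircle) (t : UnitAddCircle) : ‖rotCorr B B' t‖ ≤ 1 := by
  rw [rotCorr, Real.norm_of_nonneg ENNReal.toReal_nonneg]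
  exact ENNReal.toReal_le_of_le_ofReal zero_le_one (by simpa using prob_le_one)

lemma abs_integral_rotCorr_sub_le {B B' : Set UnitAddCircle} (hB' : MeasurableSet B')
    {f g : UnitAddCircle → UnitAddCircle} (hf : Measurable f) (hg : Measurable g) {ε : ℝ}
    (h : ∀ z, dist (rotCorr B B' (f z)) (rotCorr B B' (g z)) ≤ ε) :
    |(∫ z, rotCorr B B' (f z)) - ∫ z, rotCorr B B' (g z)| ≤ ε := by
  have hi : ∀ {f : UnitAddCircle → UnitAddCircle}, Measurable f →
      Integrable (fun z => rotCorr B B' (f z)) := fun hf =>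
    Integrable.of_bound ((continuous_rotCorr B hB').measurable.comp hf).aestronglyMeasurable 1
      (Eventually.of_forall fun z => rotCorr_le_one B B' _)
  rw [← integral_sub (hi hf) (hi hg), ← Real.norm_eq_abs]
  refine (norm_integral_le_of_norm_le_const (Eventually.of_forall h)).trans ?_
  simp

/-- The integral of the correlations along `z ↦ l z` with `l ∈ {0, 1}`. -/
lemma integral_rotCorr_mul {l : ℝ} (hl : l = 0 ∨ l = 1) {B B' : Set UnitAddCircle}
    (hB : MeasurableSet B) (hB' : MeasurableSet B') :
    ∫ z, rotCorr B B' ((l * circleRep z : ℝ) : UnitAddCircle) =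
      (1 - l) * (volume (B ∩ B')).toReal + l * (volume B).toReal * (volume B').toReal := by
  rcases hl with rfl | rfl
  · simp [rotCorr]
  · simp only [one_mul, coe_circleRep, integral_rotCorr hB hB']
    simp

lemma dist_mul_circleIndex_le {l : ℝ} (hl : l = 0 ∨ l = 1) {R : ℕ} (hR : 0 < R)
    (y : UnitAddCircle) :
    dist ((l * (circleIndex R y / R) : ℝ) : UnitAddCircle) ((l * circleRep y : ℝ) : UnitAddCircle)
      ≤ 1 / R := by
  rcases hl with rfl | rfl
  · simp
  · simpa [coe_circleRep] using dist_circleIndex_le hR y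

lemma exists_forall_dist_rotCorr_lt {ι : Type*} [Finite ι] {B : ι → Set UnitAddCircle}
    (hB : ∀ i, MeasurableSet (B i)) {ε : ℝ} (hε : 0 < ε) :
    ∃ η > 0, ∀ i i' s t, dist s t < η →
      dist (rotCorr (B i) (B i') s) (rotCorr (B i) (B i') t) < ε := by
  have h : ∀ i i', ∀ᶠ p : UnitAddCircle × UnitAddCircle in uniformity UnitAddCircle,
      dist (rotCorr (B i) (B i') p.1) (rotCorr (B i) (B i') p.2) < ε := fun i i' =>
    (CompactSpace.uniformContinuous_of_continuous (continuous_rotCorr (B i) (hB i')))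
      (Metric.dist_mem_uniformity hε)
  obtain ⟨η, hη, h'⟩ := Metric.mem_uniformity_dist.1
    (eventually_all.2 fun i => eventually_all.2 (h i))
  exact ⟨η, hη, fun i i' s t hst => h' hst i i'⟩

lemma exists_forall_measure_symmDiff_add_lt {ι : Type*} [Finite ι] {B : ι → Set UnitAddCircle}
    (hB : ∀ i, MeasurableSet (B i)) (c : ℝ) {ε : ENNReal} (hε : 0 < ε) :
    ∃ δ > 0, ∀ i, ∀ x ∈ Set.Icc c (c + δ),
      volume (((fun y => y + (x : UnitAddCircle)) ⁻¹' B i) ∆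
        ((fun y => y + (c : UnitAddCircle)) ⁻¹' B i)) < ε := by
  obtain ⟨δ, hδ, h⟩ := Metric.eventually_nhds_iff.1 (eventually_all.2 fun i =>
    (tendsto_measure_symmDiff_add (hB i) (c : UnitAddCircle)).eventually_lt_const hε)
  refine ⟨δ / 2, half_pos hδ, fun i x hx => h ((dist_coe_le x c).trans_lt ?_) i⟩
  rw [abs_of_nonneg (by linarith [hx.1])]
  linarith [hx.2]

/-- The skew product of the rotations by `x z` is close to the rotation by `1 / R`, hence to
`T`. -/
lemma measure_skew_symmDiff_le (T : Aut01) {R : ℕ} (hR : 1 < R) {A : Set unitInterval}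
    (hA : MeasurableSet A) {x : UnitAddCircle → UnitAddCircle} (hx : Measurable x) {ε : ENNReal}
    (h : ∀ z, volume (((fun y => y + x z) ⁻¹' (circleTower T R ⁻¹' (T.toEquiv '' A))) ∆
      ((fun y => y + ((1 / R : ℝ) : UnitAddCircle)) ⁻¹'
        (circleTower T R ⁻¹' (T.toEquiv '' A)))) ≤ ε) :
    (volume.prod volume : Measure (UnitAddCircle × UnitAddCircle))
      ({w | circleTower T R w.2 ∈ A} ∆ {w | circleTower T R (skew x w).2 ∈ T.toEquiv '' A}) ≤
      1 / R + ε := by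
  obtain ⟨hΨ, hbad⟩ := measurePreserving_circleTower T hR
  set D := circleTower T R ⁻¹' (T.toEquiv '' A) with hD
  have hDm : MeasurableSet D := hΨ.measurable (T.measurableSet_image hA)
  set E : Set (UnitAddCircle × UnitAddCircle) :=
    {w | w.2 + x w.1 ∈ D} ∆ {w | w.2 + ((1 / R : ℝ) : UnitAddCircle) ∈ D} with hE
  have hEm : MeasurableSet E :=
    ((measurable_snd.add (hx.comp measurable_fst)) hDm).symmDiff
      ((measurable_snd.add_const _) hDm)
  have hE_le : (volume.prod volume) E ≤ ε := by
    rw [Measure.prod_apply hEm]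
    refine (lintegral_mono h).trans ?_
    simp
  have hsub : {w : UnitAddCircle × UnitAddCircle | circleTower T R w.2 ∈ A} ∆
      {w | circleTower T R (skew x w).2 ∈ T.toEquiv '' A} ⊆
      Set.univ ×ˢ {y | ¬ circleIndex R y + 1 < R} ∪ E := by
    intro w hw
    by_cases hk : circleIndex R w.2 + 1 < R
    · refine Or.inr ?_
      have h1 : w.2 + ((1 / R : ℝ) : UnitAddCircle) ∈ D ↔ circleTower T R w.2 ∈ A := by
        rw [hD, Set.mem_preimage, circleTower_add T (by omega) hk,
          T.toEquiv.injective.mem_set_image]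
      rw [hE, symmDiff_comm]
      rw [Set.mem_symmDiff] at hw ⊢
      change (w.2 + ((1 / R : ℝ) : UnitAddCircle) ∈ D ∧ _) ∨
        (_ ∧ ¬ (w.2 + ((1 / R : ℝ) : UnitAddCircle) ∈ D))
      rw [h1]
      exact hw
    · exact Or.inl ⟨trivial, hk⟩
  refine (measure_mono hsub).trans ((measure_union_le _ _).trans (add_le_add ?_ hE_le))
  rw [Measure.prod_prod, hbad, measure_univ, one_mul]

/-- Every `T` can be approximated by transformations with prescribed correlations at the times
`v j n`, for all large `n`. -/
lemma eventually_exists_near_corr {N : ℕ} {v : Fin N → Polynomial ℤ} {lam : Fin N → ℝ}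
    (hlam : ∀ j, lam j = 0 ∨ lam j = 1)
    (hli : ∀ a : Fin N → ℤ, ∑ j, Polynomial.C (a j) * v j = 0 → a = 0)
    (h0 : ∀ j, (v j).eval 0 = 0) (T : Aut01) {ι : Type*} [Finite ι] {A : ι → Set unitInterval}
    (hA : ∀ i, MeasurableSet (A i)) {ε : ℝ} (hε : 0 < ε) :
    ∀ᶠ n : ℕ in atTop, ∃ S : Aut01,
      (∀ i, volume ((S.toEquiv '' A i) ∆ (T.toEquiv '' A i)) ≤ ENNReal.ofReal ε) ∧
      ∀ j i i', |S.corr ((v j).eval (n : ℤ)) (A i) (A i') -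
        ((1 - lam j) * (volume (A i ∩ A i')).toReal +
          lam j * (volume (A i)).toReal * (volume (A i')).toReal)| ≤ ε := by
  obtain ⟨r, hr⟩ := exists_nat_gt (1 / (ε / 2))
  obtain ⟨R, hR, hRε⟩ : ∃ R : ℕ, 1 < R ∧ (1 / R : ENNReal) ≤ ENNReal.ofReal (ε / 2) := by
    refine ⟨r + 2, by omega, ?_⟩
    have hpos : (0 : ℝ) < (r + 2 : ℕ) := by positivity
    rw [← ENNReal.ofReal_natCast, ← ENNReal.ofReal_one, ← ENNReal.ofReal_div_of_pos hpos]
    refine ENNReal.ofReal_le_ofReal ?_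
    rw [div_le_comm₀ hpos (half_pos hε)]
    push_cast
    linarith
  obtain ⟨hΨ, -⟩ := measurePreserving_circleTower T hR
  have hTA : ∀ i, MeasurableSet (T.toEquiv '' A i) := fun i => T.measurableSet_image (hA i)
  have hD : ∀ i, MeasurableSet (circleTower T R ⁻¹' A i) := fun i => hΨ.measurable (hA i)
  obtain ⟨δ, hδ, hδ'⟩ := exists_forall_measure_symmDiff_add_lt
    (fun i => hΨ.measurable (hTA i)) (1 / R) (ENNReal.ofReal_pos.2 (half_pos hε))
  obtain ⟨η, hη, hη'⟩ := exists_forall_dist_rotCorr_lt hD hε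
  obtain ⟨C, hC, hCη⟩ : ∃ C : ℕ, 0 < C ∧ (1 / C : ℝ) < η / 2 := by
    obtain ⟨C, hC⟩ := exists_nat_one_div_lt (half_pos hη)
    exact ⟨C + 1, C.succ_pos, by exact_mod_cast hC⟩
  have hev : ∀ᶠ n : ℕ in atTop, ∀ c ∈ Finset.range C, ∃ x ∈ Set.Icc (1 / R : ℝ) (1 / R + δ),
      dist (torusLine (fun j => (v j).eval (n : ℤ)) x)
        (fun j => ((lam j * (c / C) : ℝ) : UnitAddCircle)) < η / 2 :=
    (Filter.eventually_all_finset _).2 fun c _ =>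
      eventually_exists_torusLine_near hli h0 (by linarith) _ (half_pos hη)
  filter_upwards [hev] with n hn
  choose! X hX hXd using hn
  set x : UnitAddCircle → UnitAddCircle := fun z => ((X (circleIndex C z) : ℝ) : UnitAddCircle)
    with hx_def
  have hx : Measurable x :=
    (measurable_from_top (f := fun c : ℕ => ((X c : ℝ) : UnitAddCircle))).comp
      (measurable_circleIndex C)
  have hmem : ∀ z, circleIndex C z ∈ Finset.range C := fun z =>
    Finset.mem_range.2 (circleIndex_lt hC z)
  have hdist : ∀ j z, dist ((v j).eval (n : ℤ) • x z)
      ((lam j * circleRep z : ℝ) : UnitAddCircle) < η := fun j z => by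
    have h1 := (dist_le_pi_dist _ _ j).trans_lt (hXd _ (hmem z))
    have h2 := dist_mul_circleIndex_le (hlam j) hC z
    have h3 : (v j).eval (n : ℤ) • x z =
        torusLine (fun j => (v j).eval (n : ℤ)) (X (circleIndex C z)) j := by
      rw [hx_def, torusLine, ← AddCircle.coe_zsmul, zsmul_eq_mul]
    rw [h3]
    linarith [dist_triangle (torusLine (fun j => (v j).eval (n : ℤ)) (X (circleIndex C z)) j)
      ((lam j * (circleIndex C z / C) : ℝ) : UnitAddCircle)
      ((lam j * circleRep z : ℝ) : UnitAddCircle)]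
  have hskew := measurePreserving_skew hx
  have hskew' : MeasurePreserving (skew x).symm (volume.prod volume) (volume.prod volume) := by
    have h : (skew x).symm = skew (-x) := by ext p <;> simp [skew, sub_eq_add_neg]
    rw [h]
    exact measurePreserving_skew hx.neg
  obtain ⟨S, hScorr, hSdist⟩ := exists_transport
    (hΨ.comp (measurePreserving_snd (μ := (volume : Measure UnitAddCircle)))) hskew hskew'
    (A := Sum.elim A fun i => T.toEquiv '' A i) (by
      rintro (i | i)
      exacts [hA i, hTA i])
  refine ⟨S, fun i => ?_, fun j i i' => ?_⟩
  · refine (hSdist (Sum.inl i) (Sum.inr i)).le.trans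
      ((measure_skew_symmDiff_le T hR (hA i) hx
        fun z => (hδ' i _ (hX _ (hmem z))).le).trans ?_)
    refine (add_le_add_left hRε _).trans ?_
    rw [← ENNReal.ofReal_add (half_pos hε).le (half_pos hε).le, add_halves]
  · have h1 := (hScorr ((v j).eval (n : ℤ)) (Sum.inl i) (Sum.inl i')).trans
      (toReal_measure_skew hx ((v j).eval (n : ℤ)) (hD i) (hD i'))
    have h2 := integral_rotCorr_mul (hlam j) (hD i) (hD i')
    rw [← Set.preimage_inter, hΨ.measure_preimage (hA i).nullMeasurableSet,
      hΨ.measure_preimage (hA i').nullMeasurableSet,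
      hΨ.measure_preimage ((hA i).inter (hA i')).nullMeasurableSet] at h2
    simp only [Sum.elim_inl] at h1
    rw [h1, ← h2]
    refine abs_integral_rotCorr_sub_le (hD i') ((continuous_zsmul _).measurable.comp hx) ?_
      fun z => (hη' i i' _ _ (hdist j z)).le
    exact AddCircle.measurable_mk'.comp
      ((measurable_subtype_coe.comp measurable_circleRep).const_mul _)

/-- The limit correlation `(1 - l) μ(A ∩ B) + l μ(A) μ(B)`. -/
def limitCorr (l : ℝ) (A B : Set unitInterval) : ℝ :=
  (1 - l) * (volume (A ∩ B)).toReal + l * (volume A).toReal * (volume B).toReal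

lemma abs_limitCorr_sub_le (T : Aut01) {l : ℝ} (hl : l = 0 ∨ l = 1) {A A' B B' : Set unitInterval}
    (hB : MeasurableSet B) (hB' : MeasurableSet B') :
    |limitCorr l A B - limitCorr l A' B'| ≤
      (volume (A ∆ A')).toReal + (volume (B ∆ B')).toReal := by
  rcases hl with rfl | rfl
  · simpa [limitCorr, corr] using T.abs_corr_sub_corr_le 0 (A := A) (A' := A') hB hB'
  · have h1 := abs_toReal_sub_le (μ := volume) A A'
    have h2 := abs_toReal_sub_le (μ := volume) B B'
    have h3 : ∀ C : Set unitInterval, |(volume C).toReal| ≤ 1 := fun C => by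
      rw [abs_of_nonneg ENNReal.toReal_nonneg]
      exact ENNReal.toReal_le_of_le_ofReal zero_le_one (by simpa using prob_le_one)
    have h4 : limitCorr 1 A B - limitCorr 1 A' B' =
        ((volume A).toReal - (volume A').toReal) * (volume B).toReal +
          (volume A').toReal * ((volume B).toReal - (volume B').toReal) := by
      simp only [limitCorr]
      ring
    rw [h4]
    refine (abs_add_le _ _).trans (add_le_add ?_ ?_)
    · rw [abs_mul]
      exact (mul_le_of_le_one_right (abs_nonneg _) (h3 B)).trans h1
    · rw [abs_mul]
      exact (mul_le_of_le_one_left (abs_nonneg _) (h3 A')).trans h2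

section NearLimit

variable {N : ℕ} (lam : Fin N → ℝ) (v : Fin N → Polynomial ℤ)

/-- The transformations whose correlations at the times `v j n` are close to the limit ones, on
dyadic sets of rank `m`. -/
def nearLimit (m n : ℕ) : Set Aut01 :=
  {T | ∀ (j : Fin N) (s s' : (Finset.range (2 ^ m)).powerset),
    |T.corr ((v j).eval (n : ℤ)) (dyadicUnion m s) (dyadicUnion m s') -
      limitCorr (lam j) (dyadicUnion m s) (dyadicUnion m s')| < 1 / ((m : ℝ) + 1)}

lemma isOpen_nearLimit (m n : ℕ) : IsOpen (nearLimit lam v m n) := by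
  simp only [nearLimit, Set.ofPred_forall]
  refine isOpen_iInter_of_finite fun j => isOpen_iInter_of_finite fun s =>
    isOpen_iInter_of_finite fun s' => isOpen_lt ?_ continuous_const
  exact ((continuous_corr _ _ (measurableSet_dyadicUnion _ _)).sub continuous_const).abs

variable {lam v}

lemma tendsto_corr_of_mem_nearLimit (hlam : ∀ j, lam j = 0 ∨ lam j = 1) {T : Aut01} {n : ℕ → ℕ}
    (hT : ∀ m, T ∈ nearLimit lam v m (n m)) (j : Fin N) {A B : Set unitInterval}
    (hA : MeasurableSet A) (hB : MeasurableSet B) :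
    Tendsto (fun m => T.corr ((v j).eval (n m : ℤ)) A B) atTop (𝓝 (limitCorr (lam j) A B)) := by
  rw [Metric.tendsto_atTop]
  intro ε hε
  have hε5 : (0 : ℝ) < ε / 5 := by positivity
  have hε' : ENNReal.ofReal (ε / 5) ≠ 0 := (ENNReal.ofReal_pos.2 hε5).ne'
  obtain ⟨a, ha⟩ := exists_dyadicUnion_approx hA hε'
  obtain ⟨b, hb⟩ := exists_dyadicUnion_approx hB hε'
  obtain ⟨M, hM⟩ := exists_nat_one_div_lt hε5
  refine ⟨max a (max b M), fun m hm => ?_⟩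
  obtain ⟨s, hs, hsA⟩ := ha m ((le_max_left _ _).trans hm)
  obtain ⟨s', hs', hsB⟩ := hb m ((le_max_left _ _).trans ((le_max_right _ _).trans hm))
  have hMm : M ≤ m := (le_max_right _ _).trans ((le_max_right _ _).trans hm)
  have h1 := hT m j ⟨s, Finset.mem_powerset.2 hs⟩ ⟨s', Finset.mem_powerset.2 hs'⟩
  have h2 := T.abs_corr_sub_corr_le ((v j).eval (n m : ℤ)) (A := A) (A' := dyadicUnion m s) hB
    (measurableSet_dyadicUnion m s')
  have h3 := abs_limitCorr_sub_le T (hlam j) (A := A) (A' := dyadicUnion m s) hB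
    (measurableSet_dyadicUnion m s')
  have h4 := (ENNReal.lt_ofReal_iff_toReal_lt (measure_ne_top _ _)).1 hsA
  have h5 := (ENNReal.lt_ofReal_iff_toReal_lt (measure_ne_top _ _)).1 hsB
  have h6 := one_div_le_one_div_of_le (by positivity : (0 : ℝ) < (M : ℝ) + 1)
    (by exact_mod_cast Nat.succ_le_succ hMm : (M : ℝ) + 1 ≤ (m : ℝ) + 1)
  dsimp only at h1
  rw [abs_lt] at h1
  rw [abs_le] at h2 h3
  rw [Real.dist_eq, abs_lt]
  constructor <;> linarith [h1.1, h1.2, h2.1, h2.2, h3.1, h3.2]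

lemma setOf_exists_tendsto_corr_eq (hlam : ∀ j, lam j = 0 ∨ lam j = 1) :
    {T : Aut01 | ∃ n : ℕ → ℕ, StrictMono n ∧
        ∀ j : Fin N, ∀ A B : Set unitInterval, MeasurableSet A → MeasurableSet B →
          Tendsto (fun k => T.corr ((v j).eval ((n k : ℤ))) A B) atTop
            (𝓝 (limitCorr (lam j) A B))} =
      ⋂ m, ⋃ n ≥ m, nearLimit lam v m n := by
  ext T
  simp only [Set.mem_iInter, Set.mem_iUnion, exists_prop]
  constructor
  · rintro ⟨n, hn, h⟩ m
    have hpos : (0 : ℝ) < 1 / ((m : ℝ) + 1) := by positivity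
    have hev : ∀ᶠ k in atTop, T ∈ nearLimit lam v m (n k) :=
      eventually_all.2 fun j => eventually_all.2 fun s => eventually_all.2 fun s' =>
        (h j (dyadicUnion m s) (dyadicUnion m s') (measurableSet_dyadicUnion _ _)
          (measurableSet_dyadicUnion _ _)).eventually (Metric.ball_mem_nhds _ hpos)
    obtain ⟨k, hk, hkm⟩ := (hev.and (hn.tendsto_atTop.eventually_ge_atTop m)).exists
    exact ⟨n k, hkm, hk⟩
  · intro h
    choose n hnm hn using h
    obtain ⟨φ, hφ, hnφ⟩ := strictMono_subseq_of_tendsto_atTop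
      (tendsto_atTop_mono hnm tendsto_id)
    exact ⟨n ∘ φ, hnφ, fun j A B hA hB =>
      (tendsto_corr_of_mem_nearLimit hlam hn j hA hB).comp hφ.tendsto_atTop⟩

lemma dense_iUnion_nearLimit (hlam : ∀ j, lam j = 0 ∨ lam j = 1)
    (hli : ∀ a : Fin N → ℤ, ∑ j, Polynomial.C (a j) * v j = 0 → a = 0)
    (h0 : ∀ j, (v j).eval 0 = 0) (m : ℕ) : Dense (⋃ n ≥ m, nearLimit lam v m n) := by
  intro T
  have hstep : ∀ k : ℕ, ∃ S ∈ ⋃ n ≥ m, nearLimit lam v m n,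
      ∀ ℓ < k, ∀ i < 2 ^ (ℓ + 1), volume ((S.toEquiv '' dyadic (ℓ + 1) i) ∆
        (T.toEquiv '' dyadic (ℓ + 1) i)) ≤ ENNReal.ofReal (1 / ((k : ℝ) + 1)) := by
    intro k
    have hm : (0 : ℝ) < 1 / ((m : ℝ) + 1) / 2 := by positivity
    have hk : (0 : ℝ) < 1 / ((k : ℝ) + 1) := by positivity
    let A : (Finset.range (2 ^ m)).powerset ⊕ (Fin k × Fin (2 ^ k)) → Set unitInterval :=
      Sum.elim (fun s => dyadicUnion m s) fun p => dyadic (p.1 + 1) p.2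
    have hA : ∀ i, MeasurableSet (A i) := by
      rintro (s | p)
      exacts [measurableSet_dyadicUnion _ _, measurableSet_dyadic _ _]
    obtain ⟨n, ⟨S, hS1, hS2⟩, hn⟩ := ((eventually_exists_near_corr hlam hli h0 T hA
      (lt_min hm hk)).and (eventually_ge_atTop m)).exists
    refine ⟨S, Set.mem_iUnion₂.2 ⟨n, hn, fun j s s' => ?_⟩, fun ℓ hℓ i hi => ?_⟩
    · refine (hS2 j (Sum.inl s) (Sum.inl s')).trans_lt ((min_le_left _ _).trans_lt ?_)
      exact half_lt_self (by positivity)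
    · have hi' : i < 2 ^ k := hi.trans_le (Nat.pow_le_pow_right two_pos hℓ)
      exact (hS1 (Sum.inr (⟨ℓ, hℓ⟩, ⟨i, hi'⟩))).trans
        (ENNReal.ofReal_le_ofReal (min_le_right _ _))
  choose S hS hST using hstep
  refine mem_closure_of_tendsto (f := S) (b := atTop) ?_ (Eventually.of_forall hS)
  refine le_nhds_of_tendsto_dyadic fun ℓ i hi => tendsto_map'_iff.2 ?_
  have hlim : Tendsto (fun k : ℕ => ENNReal.ofReal (1 / ((k : ℝ) + 1))) atTop (𝓝 0) := by
    rw [← ENNReal.ofReal_zero]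
    exact ENNReal.tendsto_ofReal tendsto_one_div_add_atTop_nhds_zero_nat
  refine tendsto_of_tendsto_of_tendsto_of_le_of_le' tendsto_const_nhds hlim
    (Eventually.of_forall fun _ => zero_le) ?_
  filter_upwards [eventually_gt_atTop ℓ] with k hk
  exact hST k ℓ hk i hi

end NearLimit

end Aut01

/-- For `λ_1,…,λ_N ∈ {0,1}` and ℚ-linearly independent `v_1,…,v_N ∈ ℤ[x]`
with `v_j(0) = 0`, the set of `T` admitting a strictly increasing `(n_k)` with
`μ(A ∩ T^{-v_j(n_k)}B) → (1-λ_j)μ(A∩B) + λ_j μ(A)μ(B)` for all `j` and measurable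
`A,B` is a dense `G_δ` in the weak topology. -/
theorem stmt_2 (N : ℕ) (lam : Fin N → ℝ) (hlam : ∀ j, lam j = 0 ∨ lam j = 1)
    (v : Fin N → Polynomial ℤ)
    (hli : ∀ a : Fin N → ℤ, ∑ j, Polynomial.C (a j) * v j = 0 → a = 0)
    (h0 : ∀ j, (v j).eval 0 = 0) :
    IsGδ {T : Aut01 | ∃ n : ℕ → ℕ, StrictMono n ∧
        ∀ j : Fin N, ∀ A B : Set unitInterval, MeasurableSet A → MeasurableSet B →
          Tendsto (fun k => T.corr ((v j).eval ((n k : ℤ))) A B) atTop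
            (𝓝 ((1 - lam j) * (volume (A ∩ B)).toReal
              + lam j * (volume A).toReal * (volume B).toReal))} ∧
    Dense {T : Aut01 | ∃ n : ℕ → ℕ, StrictMono n ∧
        ∀ j : Fin N, ∀ A B : Set unitInterval, MeasurableSet A → MeasurableSet B →
          Tendsto (fun k => T.corr ((v j).eval ((n k : ℤ))) A B) atTop
            (𝓝 ((1 - lam j) * (volume (A ∩ B)).toReal
              + lam j * (volume A).toReal * (volume B).toReal))} := by
  have hopen : ∀ m, IsOpen (⋃ n ≥ m, Aut01.nearLimit lam v m n) := fun m =>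
    isOpen_biUnion fun n _ => Aut01.isOpen_nearLimit lam v m n
  have heq := Aut01.setOf_exists_tendsto_corr_eq (v := v) hlam
  simp only [Aut01.limitCorr] at heq
  rw [heq]
  exact ⟨IsGδ.iInter_of_isOpen hopen, dense_iInter_of_isOpen hopen
    (Aut01.dense_iUnion_nearLimit hlam hli h0)⟩
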